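/- Let Ĝ be a graph with maximal spectral radius in Bl(k,φ). Then every block of Ĝ having at most 3 vertices (i.e., every block isomorphic to K_2 or K_3) is a pendant block of Ĝ. -/

import Mathlib

namespace SpectralBlock

variable {V : Type*}

open Classical in
/-- The real adjacency matrix of a simple graph. -/
noncomputable def adjMat [Fintype V] (G : SimpleGraph V) : Matrix V V ℝ :=
  Matrix.of fun u v => if G.Adj u v then (1 : ℝ) else 0

/-- The spectral radius of a graph: the largest real eigenvalue of its adjacency matrix. -/
noncomputable def specRad [Fintype V] (G : SimpleGraph V) : ℝ :=
  sSup {r : ℝ | ∃ x : V → ℝ, x ≠ 0 ∧ (adjMat G).mulVec x = r • x}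

/-- A Perron vector of `G`: an entrywise positive eigenvector of the adjacency
matrix for the eigenvalue `specRad G`. -/
def IsPerron [Fintype V] (G : SimpleGraph V) (x : V → ℝ) : Prop :=
  (∀ v, 0 < x v) ∧ (adjMat G).mulVec x = specRad G • x

/-- A dissociation set: a set of vertices inducing a subgraph of maximum degree at most 1. -/
def IsDissoc (G : SimpleGraph V) (D : Set V) : Prop :=
  ∀ v ∈ D, (D ∩ {u | G.Adj v u}).ncard ≤ 1

/-- The dissociation number: the maximum cardinality of a dissociation set. -/
noncomputable def dissocNum [Fintype V] (G : SimpleGraph V) : ℕ :=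
  sSup {n : ℕ | ∃ D : Set V, IsDissoc G D ∧ D.ncard = n}

/-- A maximum dissociation set. -/
def IsMaxDissoc [Fintype V] (G : SimpleGraph V) (D : Set V) : Prop :=
  IsDissoc G D ∧ D.ncard = dissocNum G

/-- A cut vertex of a connected graph: a vertex whose removal disconnects the graph. -/
def IsCutVertex (G : SimpleGraph V) (v : V) : Prop :=
  G.Connected ∧ ¬ ((⊤ : G.Subgraph).deleteVerts {v}).coe.Connected

/-- A block of a graph, viewed as a set of vertices: a maximal set inducing a
connected subgraph having no cut vertex of its own. -/
def IsBlock (G : SimpleGraph V) (B : Set V) : Prop :=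
  (G.induce B).Connected ∧ (∀ v, ¬ IsCutVertex (G.induce B) v) ∧
    ∀ C : Set V, B ⊆ C → (G.induce C).Connected →
      (∀ v, ¬ IsCutVertex (G.induce C) v) → B = C

/-- A pendant block: a block containing at most one cut vertex of the graph. -/
def IsPendantBlock (G : SimpleGraph V) (B : Set V) : Prop :=
  IsBlock G B ∧ {v | v ∈ B ∧ IsCutVertex G v}.Subsingleton

/-- A block graph: a connected graph each of whose blocks is a complete graph. -/
def IsBlockGraph (G : SimpleGraph V) : Prop :=
  G.Connected ∧ ∀ B : Set V, IsBlock G B → B.Pairwise G.Adj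

/-- The class `Bl(k, φ)` of block graphs on `k` vertices with dissociation number `φ`. -/
def memBl (k φ : ℕ) (G : SimpleGraph (Fin k)) : Prop :=
  IsBlockGraph G ∧ dissocNum G = φ

/-- `G` has maximal spectral radius in the class `Bl(k, φ)`. -/
def MaxSpecIn (k φ : ℕ) (G : SimpleGraph (Fin k)) : Prop :=
  memBl k φ G ∧ ∀ H : SimpleGraph (Fin k), memBl k φ H → specRad H ≤ specRad G

section Part1
lemma rtg_lift {α β : Type*} {r : α → α → Prop} {s : β → β → Prop} (f : α → β)
    (h : ∀ a b, r a b → s (f a) (f b)) {a b : α} (hab : Relation.ReflTransGen r a b) :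
    Relation.ReflTransGen s (f a) (f b) := by
  induction hab with
  | refl => exact Relation.ReflTransGen.refl
  | tail _ h' ih => exact ih.tail (h _ _ h')

lemma rtg_mono {α : Type*} {r s : α → α → Prop}
    (h : ∀ a b, r a b → s a b) {a b : α} (hab : Relation.ReflTransGen r a b) :
    Relation.ReflTransGen s a b := rtg_lift id h hab

/-- `a` and `b` are linked by a walk avoiding `x`. -/
def conn (G : SimpleGraph V) (x : V) : V → V → Prop :=
  Relation.ReflTransGen (fun p q => G.Adj p q ∧ p ≠ x ∧ q ≠ x)

/-- Two neighbours of a vertex `x` linked outside `x` are adjacent. -/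
def Star (G : SimpleGraph V) : Prop :=
  ∀ x a b, G.Adj x a → G.Adj x b → conn G x a b → a = b ∨ G.Adj a b

lemma conn.symm {G : SimpleGraph V} {x a b : V} (h : conn G x a b) : conn G x b a := by
  induction h with
  | refl => exact Relation.ReflTransGen.refl
  | tail _ h ih => exact Relation.ReflTransGen.head ⟨h.1.symm, h.2.2, h.2.1⟩ ih

lemma conn.single {G : SimpleGraph V} {x a b : V} (h : G.Adj a b) (ha : a ≠ x) (hb : b ≠ x) :
    conn G x a b := Relation.ReflTransGen.single ⟨h, ha, hb⟩

lemma conn.trans {G : SimpleGraph V} {x a b c : V} (h : conn G x a b) (h' : conn G x b c) :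
    conn G x a c := Relation.ReflTransGen.trans h h'

lemma deleteVerts_connected_iff (H : SimpleGraph V) (v : V) :
    ((⊤ : H.Subgraph).deleteVerts {v}).coe.Connected ↔
      (∃ y, y ≠ v) ∧ ∀ y z, y ≠ v → z ≠ v → conn H v y z := by
  have hm : ∀ y, y ∈ ((⊤ : H.Subgraph).deleteVerts {v}).verts ↔ y ≠ v := by
    intro y; simp
  constructor
  · intro h
    refine ⟨?_, ?_⟩
    · obtain ⟨⟨y, hy⟩⟩ := h.nonempty
      exact ⟨y, (hm y).1 hy⟩
    · intro y z hy hz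
      have := h.preconnected ⟨y, (hm y).2 hy⟩ ⟨z, (hm z).2 hz⟩
      rw [SimpleGraph.reachable_iff_reflTransGen] at this
      refine rtg_lift Subtype.val ?_ this
      rintro ⟨a, ha⟩ ⟨b, hb⟩ hab
      have := hab
      simp at this
      exact ⟨this.2.2, (hm a).1 ha, (hm b).1 hb⟩
  · rintro ⟨⟨y, hy⟩, h⟩
    have : Nonempty ((⊤ : H.Subgraph).deleteVerts {v}).verts := ⟨⟨y, (hm y).2 hy⟩⟩
    refine ⟨?_⟩
    rintro ⟨a, ha⟩ ⟨b, hb⟩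
    have hab := h a b ((hm a).1 ha) ((hm b).1 hb)
    clear h
    unfold conn at hab
    induction hab with
    | refl => rfl
    | @tail c d hc hcd ih =>
      refine (ih ((hm c).2 hcd.2.1)).trans (SimpleGraph.Adj.reachable ?_)
      simp
      exact ⟨hcd.2.1, hcd.2.2, hcd.1⟩

/-- linked inside `S`, avoiding `x`. -/
def connIn (G : SimpleGraph V) (S : Set V) (x : V) : V → V → Prop :=
  Relation.ReflTransGen (fun p q => G.Adj p q ∧ (p ∈ S ∧ p ≠ x) ∧ (q ∈ S ∧ q ≠ x))

lemma connIn.symm {G : SimpleGraph V} {S : Set V} {x a b : V} (h : connIn G S x a b) :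
    connIn G S x b a := by
  induction h with
  | refl => exact Relation.ReflTransGen.refl
  | tail _ h ih => exact Relation.ReflTransGen.head ⟨h.1.symm, h.2.2, h.2.1⟩ ih

lemma connIn.mono {G : SimpleGraph V} {S T : Set V} (hST : S ⊆ T) {x a b : V}
    (h : connIn G S x a b) : connIn G T x a b := by
  refine rtg_mono ?_ h
  rintro p q ⟨h1, h2, h3⟩
  exact ⟨h1, ⟨hST h2.1, h2.2⟩, ⟨hST h3.1, h3.2⟩⟩

lemma connIn.toConn {G : SimpleGraph V} {S : Set V} {x a b : V}
    (h : connIn G S x a b) : conn G x a b := by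
  refine rtg_mono ?_ h
  rintro p q ⟨h1, h2, h3⟩
  exact ⟨h1, h2.2, h3.2⟩

lemma conn_induce {G : SimpleGraph V} {S : Set V} (x : S) (a b : S) :
    conn (G.induce S) x a b ↔ connIn G S x a b := by
  constructor
  · intro h
    refine rtg_lift Subtype.val ?_ h
    rintro ⟨a, ha⟩ ⟨b, hb⟩ ⟨h1, h2, h3⟩
    exact ⟨h1, ⟨ha, fun e => h2 (Subtype.ext e)⟩, ⟨hb, fun e => h3 (Subtype.ext e)⟩⟩
  · intro h
    obtain ⟨b, hb⟩ := b
    simp only at h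
    unfold connIn at h
    induction h with
    | refl => exact Relation.ReflTransGen.refl
    | @tail c d hc hcd ih =>
      refine Relation.ReflTransGen.tail (ih hcd.2.1.1) ⟨hcd.1, ?_, ?_⟩
      · intro e; exact hcd.2.1.2 (congrArg Subtype.val e)
      · intro e; exact hcd.2.2.2 (congrArg Subtype.val e)

/-- nonseparability criterion -/
lemma nonsep_of {G : SimpleGraph V} {S : Set V} (h2 : ∀ x ∈ S, ∃ y ∈ S, y ≠ x)
    (h : ∀ x ∈ S, ∀ y ∈ S, ∀ z ∈ S, y ≠ x → z ≠ x → connIn G S x y z) :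
    ∀ v, ¬ IsCutVertex (G.induce S) v := by
  rintro ⟨v, hv⟩ ⟨-, hc⟩
  apply hc
  rw [deleteVerts_connected_iff]
  constructor
  · obtain ⟨y, hy, hne⟩ := h2 v hv
    exact ⟨⟨y, hy⟩, fun e => hne (congrArg Subtype.val e)⟩
  · rintro ⟨y, hy⟩ ⟨z, hz⟩ hyv hzv
    rw [conn_induce]
    exact h v hv y hy z hz (fun e => hyv (Subtype.ext e)) (fun e => hzv (Subtype.ext e))

lemma induce_connected_of {G : SimpleGraph V} {S : Set V} (p : V) (hp : p ∈ S)
    (h : ∀ y ∈ S, Relation.ReflTransGen (fun a b => G.Adj a b ∧ a ∈ S ∧ b ∈ S) p y) :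
    (G.induce S).Connected := by
  have key : ∀ y : S, (G.induce S).Reachable ⟨p, hp⟩ y := by
    rintro ⟨y, hy⟩
    have := h y hy
    clear h
    induction this with
    | refl => rfl
    | @tail c d hc hcd ih =>
      refine (ih hcd.2.1).trans (SimpleGraph.Adj.reachable ?_)
      exact hcd.1
  have : Nonempty S := ⟨⟨p, hp⟩⟩
  exact ⟨fun a b => (key a).symm.trans (key b)⟩

lemma clique_nonsep {G : SimpleGraph V} {S : Set V} (hc : ∀ a ∈ S, ∀ b ∈ S, a ≠ b → G.Adj a b)
    {p q : V} (hp : p ∈ S) (hq : q ∈ S) (hpq : p ≠ q) :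
    (G.induce S).Connected ∧ ∀ v, ¬ IsCutVertex (G.induce S) v := by
  constructor
  · refine induce_connected_of p hp ?_
    intro y hy
    by_cases e : p = y
    · subst e; exact Relation.ReflTransGen.refl
    · exact Relation.ReflTransGen.single ⟨hc p hp y hy e, hp, hy⟩
  · refine nonsep_of ?_ ?_
    · intro x hx
      by_cases e : p = x
      · exact ⟨q, hq, by rintro rfl; exact hpq e⟩
      · exact ⟨p, hp, e⟩
    · intro x hx y hy z hz hyx hzx
      by_cases e : y = z
      · subst e; exact Relation.ReflTransGen.refl
      · exact Relation.ReflTransGen.single ⟨hc y hy z hz e, ⟨hy, hyx⟩, hz, hzx⟩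

lemma blockGraph_of_star {G : SimpleGraph V} (hc : G.Connected) (hs : Star G) :
    IsBlockGraph G := by
  refine ⟨hc, ?_⟩
  rintro B ⟨hB1, hB2, -⟩ p hp q hq hpq
  have h := hB1.preconnected ⟨p, hp⟩ ⟨q, hq⟩
  rw [SimpleGraph.reachable_iff_reflTransGen] at h
  suffices H : ∀ r : B, Relation.ReflTransGen (G.induce B).Adj ⟨p, hp⟩ r → p = r.1 ∨ G.Adj p r.1 by
    rcases H _ h with h | h
    · exact absurd h hpq
    · exact h
  intro r hr
  induction hr with
  | refl => left; rfl
  | @tail c d hc hcd ih =>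
    have hcd' : G.Adj c.1 d.1 := hcd
    rcases ih with ih | ih
    · right; rw [ih]; exact hcd
    · refine hs c.1 p d.1 ih.symm hcd' ?_
      have := hB2 c
      unfold IsCutVertex at this
      push Not at this
      have := (deleteVerts_connected_iff _ _).1 (this hB1)
      have := this.2 ⟨p, hp⟩ d (by rintro rfl; exact ih.ne rfl) (by rintro rfl; exact hcd'.ne rfl)
      exact ((conn_induce _ _ _).1 this).toConn

/-- every nonseparable set extends to a block -/
lemma exists_block [Finite V] {G : SimpleGraph V} {S : Set V} (h1 : (G.induce S).Connected)
    (h2 : ∀ v, ¬ IsCutVertex (G.induce S) v) : ∃ B, S ⊆ B ∧ IsBlock G B := by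
  obtain ⟨B, hSB, hB⟩ := Set.Finite.exists_le_maximal
    (s := {C : Set V | (G.induce C).Connected ∧ ∀ v, ¬ IsCutVertex (G.induce C) v})
    (Set.toFinite _) (a := S) ⟨h1, h2⟩
  refine ⟨B, hSB, hB.prop.1, hB.prop.2, ?_⟩
  intro C hBC hC1 hC2
  exact le_antisymm hBC (hB.le_of_ge ⟨hC1, hC2⟩ hBC)

lemma walk_connIn {G : SimpleGraph V} {x : V} {a b : V} (p : G.Walk a b) (hx : x ∉ p.support) :
    ∀ y ∈ p.support, connIn G {z | z ∈ p.support} x y b := by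
  induction p with
  | nil => intro y hy; simp at hy; subst hy; exact Relation.ReflTransGen.refl
  | @cons a c b h p ih =>
    intro y hy
    simp only [SimpleGraph.Walk.support_cons, List.mem_cons, not_or] at hx hy
    have ih' := ih hx.2
    have hsub : {z | z ∈ p.support} ⊆ {z | z ∈ (SimpleGraph.Walk.cons h p).support} := by
      intro z hz; simp at hz ⊢; right; exact hz
    rcases hy with rfl | hy
    · refine Relation.ReflTransGen.head ⟨h, ?_, ?_⟩ ((ih' c (by simp)).mono hsub)
      · simp; exact fun e => hx.1 e.symm
      · simp; intro e; apply hx.2; rw [← e]; simp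
    · exact (ih' y hy).mono hsub

lemma path_connIn {G : SimpleGraph V} {x : V} {a b : V} (p : G.Walk a b) (hp : p.IsPath) :
    ∀ y ∈ p.support, y ≠ x → (a ≠ x ∧ connIn G {z | z ∈ p.support} x y a) ∨
      (b ≠ x ∧ connIn G {z | z ∈ p.support} x y b) := by
  induction p with
  | nil => intro y hy hyx; simp at hy; subst hy; exact Or.inl ⟨hyx, Relation.ReflTransGen.refl⟩
  | @cons a c b h p ih =>
    intro y hy hyx
    rw [SimpleGraph.Walk.cons_isPath_iff] at hp
    have ih' := ih hp.1
    have hsub : {z | z ∈ p.support} ⊆ {z | z ∈ (SimpleGraph.Walk.cons h p).support} := by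
      intro z hz; simp at hz ⊢; right; exact hz
    simp only [SimpleGraph.Walk.support_cons, List.mem_cons] at hy
    rcases hy with rfl | hy
    · exact Or.inl ⟨hyx, Relation.ReflTransGen.refl⟩
    · by_cases hax : a = x
      · subst hax
        refine Or.inr ⟨?_, (walk_connIn p hp.2 y hy).mono hsub⟩
        rintro rfl; exact hp.2 (by simp)
      · rcases ih' y hy hyx with ⟨h1, h2⟩ | ⟨h1, h2⟩
        · left
          refine ⟨hax, Relation.ReflTransGen.tail (h2.mono hsub) ⟨h.symm, ?_, ?_⟩⟩
          · simp [h1]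
          · simp [hax]
        · exact Or.inr ⟨h1, h2.mono hsub⟩

lemma walk_of_conn {G : SimpleGraph V} {x a b : V} (h : conn G x a b) (ha : a ≠ x) :
    ∃ p : G.Walk a b, p.IsPath ∧ x ∉ p.support := by
  classical
  suffices ∃ p : G.Walk a b, x ∉ p.support by
    obtain ⟨p, hp⟩ := this
    exact ⟨p.bypass, p.bypass_isPath, fun h => hp (p.support_bypass_subset_support h)⟩
  induction h with
  | refl => exact ⟨SimpleGraph.Walk.nil, by simpa using ha.symm⟩
  | @tail c d hc hcd ih =>
    obtain ⟨p, hp⟩ := ih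
    refine ⟨p.concat hcd.1, ?_⟩
    rw [SimpleGraph.Walk.support_concat]
    simp [hp, hcd.2.2.symm]

lemma star_of_blockGraph [Finite V] {G : SimpleGraph V} (h : IsBlockGraph G) : Star G := by
  intro x a b hxa hxb hconn
  by_cases hab : a = b
  · exact Or.inl hab
  right
  obtain ⟨p, hp, hxp⟩ := walk_of_conn hconn hxa.ne'
  let S : Set V := insert x {z | z ∈ p.support}
  have hsub : {z | z ∈ p.support} ⊆ S := Set.subset_insert _ _
  have hxS : x ∈ S := Set.mem_insert _ _
  have haS : a ∈ S := hsub (by simp)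
  have hbS : b ∈ S := hsub (by simp)
  have h1 : (G.induce S).Connected := by
    refine induce_connected_of x hxS ?_
    have hwb := walk_connIn p hxp
    have hb : Relation.ReflTransGen (fun a b => G.Adj a b ∧ a ∈ S ∧ b ∈ S) x b :=
      Relation.ReflTransGen.single ⟨hxb, hxS, hbS⟩
    intro y hy
    rcases hy with rfl | hy
    · exact Relation.ReflTransGen.refl
    · refine hb.trans (rtg_mono ?_ (hwb y hy).symm)
      rintro p q ⟨h1, h2, h3⟩
      exact ⟨h1, hsub h2.1, hsub h3.1⟩
  have h2 : ∀ v, ¬ IsCutVertex (G.induce S) v := by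
    refine nonsep_of ?_ ?_
    · intro y hy
      by_cases e : a = y
      · exact ⟨b, hbS, by rintro rfl; exact hab e⟩
      · exact ⟨a, haS, e⟩
    · intro v hv
      by_cases hvx : v = x
      · subst hvx
        have key : ∀ y ∈ S, y ≠ v → connIn G S v y b := by
          intro y hy hyv
          rcases hy with rfl | hy
          · exact absurd rfl hyv
          · exact (walk_connIn p hxp y hy).mono hsub
        intro y hy z hz hyv hzv
        exact (key y hy hyv).trans (key z hz hzv).symm
      · have key : ∀ y ∈ S, y ≠ v → connIn G S v y x := by
          intro y hy hyv
          rcases hy with rfl | hy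
          · exact Relation.ReflTransGen.refl
          · rcases path_connIn p hp y hy hyv with ⟨h1, h2⟩ | ⟨h1, h2⟩
            · exact Relation.ReflTransGen.tail (h2.mono hsub) ⟨hxa.symm, ⟨haS, h1⟩, hxS, Ne.symm hvx⟩
            · exact Relation.ReflTransGen.tail (h2.mono hsub) ⟨hxb.symm, ⟨hbS, h1⟩, hxS, Ne.symm hvx⟩
        intro y hy z hz hyv hzv
        exact (key y hy hyv).trans (key z hz hzv).symm
  obtain ⟨B, hSB, hB⟩ := exists_block h1 h2
  exact h.2 B hB (hSB haS) (hSB hbS) hab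

/-- A maximal clique in the strong sense: no outside vertex sees two members. -/
def Blk (G : SimpleGraph V) (B : Set V) : Prop :=
  (∀ a ∈ B, ∀ b ∈ B, a ≠ b → G.Adj a b) ∧
    ∀ z, ∀ p ∈ B, ∀ q ∈ B, p ≠ q → G.Adj z p → G.Adj z q → z ∈ B

lemma star_clique {G : SimpleGraph V} (hs : Star G) {B : Set V}
    (hB : ∀ a ∈ B, ∀ b ∈ B, a ≠ b → G.Adj a b) {z p q : V} (hp : p ∈ B) (hq : q ∈ B)
    (hpq : p ≠ q) (hzp : G.Adj z p) (hzq : G.Adj z q) : ∀ r ∈ B, z = r ∨ G.Adj z r := by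
  intro r hr
  by_cases hrp : r = p
  · subst hrp; exact Or.inr hzp
  refine hs p z r hzp.symm (hB p hp r hr (Ne.symm hrp)) ?_
  refine (conn.single hzq hzp.ne hpq.symm).trans ?_
  by_cases hqr : q = r
  · subst hqr; exact Relation.ReflTransGen.refl
  · exact conn.single (hB q hq r hr hqr) hpq.symm hrp

lemma blk_of_block {G : SimpleGraph V} (hs : Star G) {B : Set V}
    (hB : IsBlock G B) (hc : B.Pairwise G.Adj) : Blk G B := by
  have hc' : ∀ a ∈ B, ∀ b ∈ B, a ≠ b → G.Adj a b := fun a ha b hb h => hc ha hb h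
  refine ⟨hc', ?_⟩
  intro z p hp q hq hpq hzp hzq
  by_contra hz
  have hall := star_clique hs hc' hp hq hpq hzp hzq
  have hall' : ∀ r ∈ B, G.Adj z r := by
    intro r hr
    rcases hall r hr with h | h
    · subst h; exact absurd hr hz
    · exact h
  have := clique_nonsep (G := G) (S := insert z B) (p := p) (q := q) ?_ (Set.mem_insert_of_mem _ hp)
    (Set.mem_insert_of_mem _ hq) hpq
  · have e := hB.2.2 (insert z B) (Set.subset_insert _ _) this.1 this.2
    exact hz (e ▸ Set.mem_insert z B)
  · rintro a (rfl | ha) b (rfl | hb) hab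
    · exact absurd rfl hab
    · exact hall' b hb
    · exact (hall' a ha).symm
    · exact hc' a ha b hb hab

/-- The block spanned by an edge. -/
def edgeBlk (G : SimpleGraph V) (u c : V) : Set V :=
  {z | z = u ∨ z = c ∨ (G.Adj z u ∧ G.Adj z c)}

lemma blk_edgeBlk {G : SimpleGraph V} (hs : Star G) {u c : V} (huc : G.Adj u c) :
    Blk G (edgeBlk G u c) := by
  have hu : u ∈ edgeBlk G u c := Or.inl rfl
  have hc : c ∈ edgeBlk G u c := Or.inr (Or.inl rfl)
  have hcl : ∀ a ∈ edgeBlk G u c, ∀ b ∈ edgeBlk G u c, a ≠ b → G.Adj a b := by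
    rintro a (rfl | rfl | ⟨ha1, ha2⟩) b (rfl | rfl | ⟨hb1, hb2⟩) hab
    · exact absurd rfl hab
    · exact huc
    · exact hb1.symm
    · exact huc.symm
    · exact absurd rfl hab
    · exact hb2.symm
    · exact ha1
    · exact ha2
    · rcases hs u a b ha1.symm hb1.symm ((conn.single ha2 ha1.ne huc.ne').trans
        (conn.single hb2.symm huc.ne' hb1.ne)) with h | h
      · exact absurd h hab
      · exact h
  refine ⟨hcl, ?_⟩
  intro z p hp q hq hpq hzp hzq
  have h := star_clique hs hcl hp hq hpq hzp hzq
  rcases h u hu with h1 | h1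
  · exact Or.inl h1
  rcases h c hc with h2 | h2
  · exact Or.inr (Or.inl h2)
  · exact Or.inr (Or.inr ⟨h1, h2⟩)

/-- A cut vertex in `B` has a neighbour outside `B`. -/
lemma outer_of_cut {G : SimpleGraph V} {B : Set V} (hB : Blk G B) {u v : V}
    (huv : u ≠ v) (hu : IsCutVertex G u) : ∃ c, G.Adj u c ∧ c ∉ B := by
  by_contra hcon
  push Not at hcon
  apply hu.2
  rw [deleteVerts_connected_iff]
  refine ⟨⟨v, huv.symm⟩, ?_⟩
  intro y z hy hz
  have hyz := hu.1.preconnected y z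
  rw [SimpleGraph.reachable_iff_reflTransGen] at hyz
  have key : ∀ r, Relation.ReflTransGen G.Adj y r →
      (r ≠ u ∧ conn G u y r) ∨ (r = u ∧ ∃ s, G.Adj u s ∧ conn G u y s) := by
    intro r hr
    induction hr with
    | refl => exact Or.inl ⟨hy, Relation.ReflTransGen.refl⟩
    | @tail c d hc hcd ih =>
      rcases ih with ⟨h1, h2⟩ | ⟨rfl, s, hs1, hs2⟩
      · by_cases hdu : d = u
        · subst hdu; exact Or.inr ⟨rfl, c, hcd.symm, h2⟩
        · exact Or.inl ⟨hdu, h2.trans (conn.single hcd h1 hdu)⟩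
      · refine Or.inl ⟨hcd.ne', hs2.trans ?_⟩
        by_cases e : s = d
        · subst e; exact Relation.ReflTransGen.refl
        · exact conn.single (hB.1 s (hcon s hs1) d (hcon d hcd) e) hs1.ne' hcd.ne'
  rcases key z hyz with h | h
  · exact h.2
  · exact absurd h.1 hz

end Part1

section Part2
/-- Merge two cliques. -/
def mergeG (G : SimpleGraph V) (B C : Set V) : SimpleGraph V where
  Adj a b := a ≠ b ∧ (G.Adj a b ∨ (a ∈ B ∪ C ∧ b ∈ B ∪ C))
  symm := ⟨by
    rintro a b ⟨h, h'⟩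
    exact ⟨h.symm, h'.imp (fun h => h.symm) (fun h => ⟨h.2, h.1⟩)⟩⟩
  loopless := ⟨fun a h => h.1 rfl⟩

/-- Contract the edge `uv` to `u`, and attach `v` to the set `Q`. -/
def shiftG (G : SimpleGraph V) (u v : V) (Q : Set V) : SimpleGraph V where
  Adj a b := a ≠ b ∧ ((a ≠ v ∧ b ≠ v ∧ (G.Adj a b ∨ (a = u ∧ G.Adj v b) ∨ (b = u ∧ G.Adj v a))) ∨
    (a = v ∧ b ∈ Q) ∨ (b = v ∧ a ∈ Q))
  symm := ⟨by
    rintro a b ⟨h, h'⟩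
    refine ⟨h.symm, ?_⟩
    rcases h' with ⟨h1, h2, h3⟩ | h | h
    · left
      refine ⟨h2, h1, ?_⟩
      rcases h3 with h | h | h
      · exact Or.inl h.symm
      · exact Or.inr (Or.inr h)
      · exact Or.inr (Or.inl h)
    · exact Or.inr (Or.inr h)
    · exact Or.inr (Or.inl h)⟩
  loopless := ⟨fun a h => h.1 rfl⟩

lemma merge_le (G : SimpleGraph V) (B C : Set V) : G ≤ mergeG G B C := by
  intro a b h
  exact ⟨h.ne, Or.inl h⟩

lemma merge_connected {G : SimpleGraph V} (h : G.Connected) (B C : Set V) :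
    (mergeG G B C).Connected := h.mono (merge_le G B C)

lemma blk_conn {G : SimpleGraph V} {B : Set V} (hB : Blk G B) {x p q : V} (hp : p ∈ B)
    (hq : q ∈ B) (hpx : p ≠ x) (hqx : q ≠ x) : conn G x p q := by
  by_cases e : p = q
  · subst e; exact Relation.ReflTransGen.refl
  · exact conn.single (hB.1 p hp q hq e) hpx hqx

lemma merge_star {G : SimpleGraph V} (hs : Star G) {B C : Set V} (hB : Blk G B) (hC : Blk G C)
    {u : V} (huB : u ∈ B) (huC : u ∈ C) : Star (mergeG G B C) := by
  have hu : ∀ p ∈ B ∪ C, p = u ∨ G.Adj u p := by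
    intro p hp
    by_cases e : p = u
    · exact Or.inl e
    · rcases hp with hp | hp
      · exact Or.inr (hB.1 u huB p hp (Ne.symm e))
      · exact Or.inr (hC.1 u huC p hp (Ne.symm e))
  -- a vertex adjacent to `u` and equal/adjacent to another member is a member
  have hmem : ∀ a p, p ∈ B ∪ C → p ≠ u → G.Adj u a → (a = p ∨ G.Adj a p) → a ∈ B ∪ C := by
    rintro a p hp hpu hua (rfl | hap)
    · exact hp
    · rcases hp with hp | hp
      · exact Or.inl (hB.2 a u huB p hp (Ne.symm hpu) hua.symm hap)
      · exact Or.inr (hC.2 a u huC p hp (Ne.symm hpu) hua.symm hap)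
  intro x a b hxa hxb hconn
  by_cases hab : a = b
  · exact Or.inl hab
  right
  refine ⟨hab, ?_⟩
  by_cases hxu : x = u
  · subst hxu
    have hxa' : G.Adj x a := by
      rcases hxa with ⟨h, h' | h'⟩
      · exact h'
      · exact (hu a h'.2).resolve_left (Ne.symm h)
    have hxb' : G.Adj x b := by
      rcases hxb with ⟨h, h' | h'⟩
      · exact h'
      · exact (hu b h'.2).resolve_left (Ne.symm h)
    have key : ∀ r, conn (mergeG G B C) x a r → conn G x a r ∨
        ((∃ p ∈ B ∪ C, p ≠ x ∧ conn G x a p) ∧ (∃ q ∈ B ∪ C, q ≠ x ∧ conn G x r q)) := by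
      intro r hr
      induction hr with
      | refl => exact Or.inl Relation.ReflTransGen.refl
      | @tail c d hc hcd ih =>
        obtain ⟨⟨hne, hcd | hcd⟩, hcx, hdx⟩ := hcd
        · rcases ih with ih | ⟨ih, q, hq1, hq2, hq3⟩
          · exact Or.inl (ih.trans (conn.single hcd hcx hdx))
          · exact Or.inr ⟨ih, q, hq1, hq2, (conn.single hcd.symm hdx hcx).trans hq3⟩
        · right
          refine ⟨?_, d, hcd.2, hdx, Relation.ReflTransGen.refl⟩
          rcases ih with ih | ⟨ih, -⟩
          · exact ⟨c, hcd.1, hcx, ih⟩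
          · exact ih
    rcases key b hconn with h | ⟨⟨p, hp, hpx, hp'⟩, q, hq, hqx, hq'⟩
    · exact Or.inl ((hs x a b hxa' hxb' h).resolve_left hab)
    · right
      refine ⟨hmem a p hp hpx hxa' (hs x a p hxa' ?_ hp'), hmem b q hq hqx hxb' (hs x b q hxb' ?_ hq')⟩
      · exact (hu p hp).resolve_left hpx
      · exact (hu q hq).resolve_left hqx
  · have toU : ∀ p ∈ B ∪ C, p ≠ x → conn G x p u := by
      rintro p (hp | hp) hpx
      · exact blk_conn hB hp huB hpx (Ne.symm hxu)
      · exact blk_conn hC hp huC hpx (Ne.symm hxu)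
    have key : conn G x a b := by
      clear hxb hab
      induction hconn with
      | refl => exact Relation.ReflTransGen.refl
      | @tail c d hc hcd ih =>
        obtain ⟨⟨hne, hcd | hcd⟩, hcx, hdx⟩ := hcd
        · exact ih.trans (conn.single hcd hcx hdx)
        · exact ih.trans ((toU c hcd.1 hcx).trans (toU d hcd.2 hdx).symm)
    -- symmetric helper
    have help : ∀ a b, a ∉ B ∪ C → x ∈ B ∪ C → b ∈ B ∪ C → G.Adj x a → b ≠ x →
        conn G x a b → False := by
      intro a b ha hx hb hxa hbx hab
      have h1 : conn G x a u := hab.trans (toU b hb hbx)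
      have hxu' : G.Adj u x := (hu x hx).resolve_left hxu
      rcases hs x a u hxa hxu'.symm h1 with rfl | h
      · exact ha (Or.inl huB)
      · exact ha (hmem a x hx hxu h.symm (Or.inr hxa.symm))
    rcases hxa with ⟨hxane, hxa | hxa⟩ <;> rcases hxb with ⟨hxbne, hxb | hxb⟩
    · exact Or.inl ((hs x a b hxa hxb key).resolve_left hab)
    · by_cases ha : a ∈ B ∪ C
      · exact Or.inr ⟨ha, hxb.2⟩
      · exact (help a b ha hxb.1 hxb.2 hxa hxbne.symm key).elim
    · by_cases hb : b ∈ B ∪ C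
      · exact Or.inr ⟨hxa.2, hb⟩
      · exact (help b a hb hxa.1 hxa.2 hxb hxane.symm key.symm).elim
    · exact Or.inr ⟨hxa.2, hxb.2⟩

lemma shift_connected {G : SimpleGraph V} (h : G.Connected) {u v : V} (huv : G.Adj u v)
    {Q : Set V} (hu : u ∈ Q) : (shiftG G u v Q).Connected := by
  classical
  have hvu : (shiftG G u v Q).Adj u v := ⟨huv.ne, Or.inr (Or.inr ⟨rfl, hu⟩)⟩
  have key : ∀ y, (shiftG G u v Q).Reachable u y := by
    intro y
    have hy := h.preconnected u y
    rw [SimpleGraph.reachable_iff_reflTransGen] at hy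
    induction hy with
    | refl => rfl
    | @tail c d hc hcd ih =>
      by_cases hd : d = v
      · subst hd; exact hvu.reachable
      by_cases hdu : d = u
      · subst hdu; rfl
      by_cases hcv : c = v
      · subst hcv
        exact SimpleGraph.Adj.reachable ⟨Ne.symm hdu, Or.inl ⟨huv.ne, hd, Or.inr (Or.inl ⟨rfl, hcd⟩)⟩⟩
      · exact ih.trans (SimpleGraph.Adj.reachable ⟨hcd.ne, Or.inl ⟨hcv, hd, Or.inl hcd⟩⟩)
  have : Nonempty V := ⟨u⟩
  exact ⟨fun a b => (key a).symm.trans (key b)⟩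

lemma contr_adj {G : SimpleGraph V} {u v a b : V} : (shiftG G u v ∅).Adj a b ↔
    a ≠ b ∧ a ≠ v ∧ b ≠ v ∧ (G.Adj a b ∨ (a = u ∧ G.Adj v b) ∨ (b = u ∧ G.Adj v a)) := by
  simp [shiftG]

lemma contr_star {G : SimpleGraph V} (hs : Star G) {u v : V} (huv : G.Adj u v) :
    Star (shiftG G u v ∅) := by
  intro x a b hxa hxb hconn
  by_cases hab : a = b
  · exact Or.inl hab
  right
  rw [contr_adj] at hxa hxb ⊢
  obtain ⟨hxane, hxv, hav, hxa⟩ := hxa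
  obtain ⟨hxbne, -, hbv, hxb⟩ := hxb
  refine ⟨hab, hav, hbv, ?_⟩
  by_cases hxu : x = u
  · subst hxu
    have h1 : conn G x a b := by
      refine rtg_mono ?_ hconn
      rintro p q ⟨h, hp, hq⟩
      rw [contr_adj] at h
      obtain ⟨-, -, -, h | h | h⟩ := h
      · exact ⟨h, hp, hq⟩
      · exact absurd h.1 hp
      · exact absurd h.1 hq
    have h2 : conn G v a b := by
      refine rtg_mono ?_ hconn
      rintro p q ⟨h, hp, hq⟩
      rw [contr_adj] at h
      obtain ⟨-, hp', hq', h | h | h⟩ := h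
      · exact ⟨h, hp', hq'⟩
      · exact absurd h.1 hp
      · exact absurd h.1 hq
    have ha' : G.Adj x a ∨ G.Adj v a := by
      rcases hxa with h | h | h
      · exact Or.inl h
      · exact Or.inr h.2
      · exact absurd h.1.symm hxane
    have hb' : G.Adj x b ∨ G.Adj v b := by
      rcases hxb with h | h | h
      · exact Or.inl h
      · exact Or.inr h.2
      · exact absurd h.1.symm hxbne
    left
    have hvv : G.Adj v a → G.Adj v b → G.Adj a b := fun h h' =>
      (hs v a b h h' h2).resolve_left hab
    rcases ha' with ha | ha <;> rcases hb' with hb | hb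
    · exact (hs x a b ha hb h1).resolve_left hab
    · refine hvv ?_ hb
      exact ((hs x a v ha huv (h1.trans (conn.single hb.symm hxbne.symm huv.ne'))).resolve_left hav).symm
    · refine hvv ha ?_
      exact ((hs x b v hb huv (h1.symm.trans (conn.single ha.symm hxane.symm huv.ne'))).resolve_left hbv).symm
    · exact hvv ha hb
  · have h1 : conn G x a b := by
      clear hxb hab hbv hxbne
      induction hconn with
      | refl => exact Relation.ReflTransGen.refl
      | @tail c d hc hcd ih =>
        obtain ⟨h, hp, hq⟩ := hcd
        rw [contr_adj] at h
        refine ih.trans ?_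
        obtain ⟨-, -, -, h | ⟨rfl, h⟩ | ⟨rfl, h⟩⟩ := h
        · exact conn.single h hp hq
        · exact (conn.single huv hp (Ne.symm hxv)).trans (conn.single h (Ne.symm hxv) hq)
        · exact (conn.single h.symm hp (Ne.symm hxv)).trans (conn.single huv.symm (Ne.symm hxv) hq)
    have hxa' : G.Adj x a ∨ (a = u ∧ G.Adj v x) := by
      rcases hxa with h | h | h
      · exact Or.inl h
      · exact absurd h.1 hxu
      · exact Or.inr h
    have hxb' : G.Adj x b ∨ (b = u ∧ G.Adj v x) := by
      rcases hxb with h | h | h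
      · exact Or.inl h
      · exact absurd h.1 hxu
      · exact Or.inr h
    rcases hxa' with ha | ⟨rfl, ha⟩ <;> rcases hxb' with hb | ⟨rfl, hb⟩
    · exact Or.inl ((hs x a b ha hb h1).resolve_left hab)
    · right; right
      refine ⟨rfl, ?_⟩
      exact ((hs x a v ha hb.symm (h1.trans (conn.single huv hxbne.symm (Ne.symm hxv)))).resolve_left
        hav).symm
    · right; left
      refine ⟨rfl, ?_⟩
      exact ((hs x b v hb ha.symm (h1.symm.trans (conn.single huv hxane.symm (Ne.symm hxv)))).resolve_left
        hbv).symm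
    · exact absurd rfl hab

lemma shift_adj_of_contr {G : SimpleGraph V} {u v : V} {Q : Set V} {a b : V}
    (h : (shiftG G u v ∅).Adj a b) : (shiftG G u v Q).Adj a b := by
  rw [contr_adj] at h
  exact ⟨h.1, Or.inl h.2⟩

lemma shift_adj_cases {G : SimpleGraph V} {u v : V} {Q : Set V} {a b : V}
    (h : (shiftG G u v Q).Adj a b) : (shiftG G u v ∅).Adj a b ∨ (a = v ∧ b ∈ Q) ∨ (b = v ∧ a ∈ Q) := by
  rw [contr_adj]
  obtain ⟨h1, h2⟩ := h
  rcases h2 with h2 | h2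
  · exact Or.inl ⟨h1, h2⟩
  · exact Or.inr h2

lemma shift_star {G : SimpleGraph V} (hs : Star G) {u v : V} (huv : G.Adj u v) {Q : Set V}
    (hvQ : v ∉ Q) (hQ : ∀ a ∈ Q, ∀ b ∈ Q, a ≠ b → (shiftG G u v ∅).Adj a b)
    (hQm : ∀ z, ∀ p ∈ Q, ∀ q ∈ Q, p ≠ q → (shiftG G u v ∅).Adj z p → (shiftG G u v ∅).Adj z q → z ∈ Q) :
    Star (shiftG G u v Q) := by
  have hK := contr_star hs huv
  set K := shiftG G u v ∅ with hKdef
  have hKv : ∀ {a b}, K.Adj a b → a ≠ v ∧ b ≠ v := by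
    intro a b h
    rw [hKdef, contr_adj] at h
    exact ⟨h.2.1, h.2.2.1⟩
  have conQ : ∀ x p q, p ∈ Q → q ∈ Q → p ≠ x → q ≠ x → conn K x p q := by
    intro x p q hp hq hpx hqx
    by_cases e : p = q
    · subst e; exact Relation.ReflTransGen.refl
    · exact conn.single (hQ p hp q hq e) hpx hqx
  have key : ∀ x a r, a ≠ v → conn (shiftG G u v Q) x a r →
      (r ≠ v ∧ conn K x a r) ∨ (r = v ∧ ∃ q ∈ Q, q ≠ x ∧ conn K x a q) := by
    intro x a r hav hr
    induction hr with
    | refl => exact Or.inl ⟨hav, Relation.ReflTransGen.refl⟩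
    | @tail c d hc hcd ih =>
      obtain ⟨h, hcx, hdx⟩ := hcd
      rcases shift_adj_cases h with h | ⟨rfl, hQd⟩ | ⟨rfl, hQc⟩
      · have := hKv h
        rcases ih with ih | ih
        · exact Or.inl ⟨this.2, ih.2.trans (conn.single h hcx hdx)⟩
        · exact absurd ih.1 this.1
      · rcases ih with ih | ⟨-, q, hq, hqx, ih⟩
        · exact absurd rfl ih.1
        · exact Or.inl ⟨by rintro rfl; exact hvQ hQd, ih.trans (conQ x q d hq hQd hqx hdx)⟩
      · rcases ih with ih | ih
        · exact Or.inr ⟨rfl, c, hQc, hcx, ih.2⟩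
        · exact absurd (ih.1 ▸ hQc) hvQ
  have side : ∀ x b, x ∈ Q → b ≠ v → (shiftG G u v Q).Adj x b → conn (shiftG G u v Q) x b v →
      b ∈ Q := by
    intro x b hx hbv hxb hc
    have hxb' : K.Adj x b := by
      rcases shift_adj_cases hxb with h | ⟨rfl, h⟩ | ⟨rfl, h⟩
      · exact h
      · exact absurd hx hvQ
      · exact absurd rfl hbv
    rcases key x b v hbv hc with h | ⟨-, q, hq, hqx, h⟩
    · exact absurd rfl h.1
    · rcases hK x b q hxb' (hQ x hx q hq (Ne.symm hqx)) h with rfl | h'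
      · exact hq
      · exact hQm b x hx q hq (Ne.symm hqx) hxb'.symm h'
  intro x a b hxa hxb hconn
  by_cases hab : a = b
  · exact Or.inl hab
  right
  by_cases hxv : x = v
  · subst hxv
    have : ∀ c, (shiftG G u x Q).Adj x c → c ∈ Q := by
      intro c hc
      rcases shift_adj_cases hc with h | ⟨_, h⟩ | ⟨rfl, h⟩
      · exact absurd rfl (hKv h).1
      · exact h
      · exact h
    exact shift_adj_of_contr (hQ a (this a hxa) b (this b hxb) hab)
  have hQx : (shiftG G u v Q).Adj x v → x ∈ Q := by
    intro h
    rcases shift_adj_cases h with h | ⟨h', h⟩ | ⟨_, h⟩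
    · exact absurd rfl (hKv h).2
    · exact absurd h' hxv
    · exact h
  by_cases hav : a = v
  · subst hav
    have := side x b (hQx hxa) (Ne.symm hab) hxb hconn.symm
    exact ⟨hab, Or.inr (Or.inl ⟨rfl, this⟩)⟩
  by_cases hbv : b = v
  · subst hbv
    have := side x a (hQx hxb) hab hxa hconn
    exact ⟨hab, Or.inr (Or.inr ⟨rfl, this⟩)⟩
  have toK : ∀ c, c ≠ v → (shiftG G u v Q).Adj x c → K.Adj x c := by
    intro c hcv hc
    rcases shift_adj_cases hc with h | ⟨h', h⟩ | ⟨h', h⟩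
    · exact h
    · exact absurd h' hxv
    · exact absurd h' hcv
  rcases key x a b hav hconn with h | h
  · exact shift_adj_of_contr ((hK x a b (toK a hav hxa) (toK b hbv hxb) h.2).resolve_left hab)
  · exact absurd h.1 hbv

/-- a block through `u` (with `v` removed) is a legal attachment set for a shift -/
lemma contr_Q {G : SimpleGraph V} (hs : Star G) {u v : V} {C : Set V} (hC : Blk G C)
    (huC : u ∈ C) (huv : G.Adj u v) :
    (∀ a ∈ C \ {v}, ∀ b ∈ C \ {v}, a ≠ b → (shiftG G u v ∅).Adj a b) ∧
    ∀ z, ∀ p ∈ C \ {v}, ∀ q ∈ C \ {v}, p ≠ q → (shiftG G u v ∅).Adj z p →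
      (shiftG G u v ∅).Adj z q → z ∈ C \ {v} := by
  constructor
  · rintro a ⟨ha, hav⟩ b ⟨hb, hbv⟩ hab
    rw [contr_adj]
    exact ⟨hab, hav, hbv, Or.inl (hC.1 a ha b hb hab)⟩
  · rintro z p ⟨hp, -⟩ q ⟨hq, -⟩ hpq hzp hzq
    rw [contr_adj] at hzp hzq
    obtain ⟨hne, hzv, hpv, hzp⟩ := hzp
    obtain ⟨hne', -, hqv, hzq⟩ := hzq
    refine ⟨?_, hzv⟩
    by_cases hzu : z = u
    · subst hzu; exact huC
    have main : ∀ q, q ∈ C → q ≠ u → q ≠ v → G.Adj v z → G.Adj z q → z ∈ C := by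
      intro q hq hqu hqv hvz hzq
      have huq := hC.1 u huC q hq (Ne.symm hqu)
      have h1 := (hs u q v huq huv ((conn.single hzq.symm hqu hzu).trans
        (conn.single hvz.symm hzu huv.ne'))).resolve_left hqv
      have hvC : v ∈ C := hC.2 v u huC q hq (Ne.symm hqu) huv.symm h1.symm
      exact hC.2 z v hvC q hq (Ne.symm hqv) hvz.symm hzq
    rcases hzp with h | h | h
    · rcases hzq with h' | h' | h'
      · exact hC.2 z p hp q hq hpq h h'
      · exact absurd h'.1 hzu
      · exact main p hp (fun e => hpq (e.trans h'.1.symm)) hpv h'.2 h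
    · exact absurd h.1 hzu
    · rcases hzq with h' | h' | h'
      · exact main q hq (fun e => hpq (h.1.trans e.symm)) hqv h.2 h'
      · exact absurd h'.1 hzu
      · exact absurd (h.1.trans h'.1.symm) hpq

end Part2

section Part3
open Matrix

lemma adjMat_herm [Fintype V] (G : SimpleGraph V) : (adjMat G).IsHermitian := by
  ext a b
  by_cases h : G.Adj a b
  · simp [adjMat, h, h.symm]
  · have h' : ¬ G.Adj b a := fun e => h e.symm
    simp [adjMat, h, h']

lemma eig_bdd [Fintype V] (G : SimpleGraph V) :
    BddAbove {r : ℝ | ∃ x : V → ℝ, x ≠ 0 ∧ (adjMat G).mulVec x = r • x} := by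
  classical
  refine ⟨Fintype.card V, ?_⟩
  rintro r ⟨x, hx, h⟩
  obtain ⟨i0, hi0⟩ : ∃ i, x i ≠ 0 := by
    by_contra hcon
    push Not at hcon
    exact hx (funext hcon)
  have : Nonempty V := ⟨i0⟩
  obtain ⟨i, hi⟩ := Finite.exists_max (fun i => |x i|)
  have hpos : 0 < |x i| := lt_of_lt_of_le (abs_pos.2 hi0) (hi i0)
  have h1 := congrFun h i
  simp only [Matrix.mulVec, dotProduct, Pi.smul_apply, smul_eq_mul] at h1
  have h2 : r * |x i| ≤ Fintype.card V * |x i| := by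
    calc r * |x i| ≤ |r * x i| := by
          rw [abs_mul]; exact mul_le_mul_of_nonneg_right (le_abs_self r) hpos.le
      _ = |∑ j, adjMat G i j * x j| := by rw [h1]
      _ ≤ ∑ j, |adjMat G i j * x j| := Finset.abs_sum_le_sum_abs _ _
      _ ≤ ∑ j : V, |x i| := by
          refine Finset.sum_le_sum ?_
          intro j _
          rw [abs_mul]
          have : |adjMat G i j| ≤ 1 := by
            simp only [adjMat, Matrix.of_apply]; split_ifs <;> simp
          calc |adjMat G i j| * |x j| ≤ 1 * |x j| := mul_le_mul_of_nonneg_right this (abs_nonneg _)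
            _ ≤ |x i| := by rw [one_mul]; exact hi j
      _ = _ := by simp
  exact le_of_mul_le_mul_right h2 hpos

lemma psd [Fintype V] [DecidableEq V] (G : SimpleGraph V) :
    (specRad G • (1 : Matrix V V ℝ) - adjMat G).PosSemidef := by
  have hh : (specRad G • (1 : Matrix V V ℝ) - adjMat G).IsHermitian := by
    refine IsHermitian.sub ?_ (adjMat_herm G)
    ext a b
    simp [Matrix.one_apply, eq_comm]
  rw [hh.posSemidef_iff_eigenvalues_nonneg]
  intro i
  have h := hh.mulVec_eigenvectorBasis i
  set μ := hh.eigenvalues i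
  have hne : (⇑(hh.eigenvectorBasis i) : V → ℝ) ≠ 0 := by
    intro h0
    have := hh.eigenvectorBasis.orthonormal.ne_zero i
    apply this
    ext j
    exact congrFun h0 j
  have : specRad G - μ ≤ specRad G := by
    refine le_csSup (eig_bdd G) ⟨_, hne, ?_⟩
    rw [sub_mulVec, smul_mulVec, one_mulVec] at h
    rw [sub_smul, ← h]
    abel
  show 0 ≤ μ
  linarith

lemma eigset_nonempty [Fintype V] [Nonempty V] (G : SimpleGraph V) :
    {r : ℝ | ∃ x : V → ℝ, x ≠ 0 ∧ (adjMat G).mulVec x = r • x}.Nonempty := by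
  classical
  have hh := adjMat_herm G
  obtain ⟨i⟩ := ‹Nonempty V›
  refine ⟨hh.eigenvalues i, ⇑(hh.eigenvectorBasis i), ?_, hh.mulVec_eigenvectorBasis i⟩
  intro h0
  have := hh.eigenvectorBasis.orthonormal.ne_zero i
  apply this
  ext j
  exact congrFun h0 j

lemma eigset_finite [Fintype V] (G : SimpleGraph V) :
    {r : ℝ | ∃ x : V → ℝ, x ≠ 0 ∧ (adjMat G).mulVec x = r • x}.Finite := by
  classical
  refine (Module.End.finite_hasEigenvalue (Matrix.toLin' (adjMat G))).subset ?_
  rintro r ⟨x, hx, h⟩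
  exact Module.End.hasEigenvalue_of_hasEigenvector (x := x)
    ⟨Module.End.mem_eigenspace_iff.2 (by simpa using h), hx⟩

lemma zero_of_form [Fintype V] (G : SimpleGraph V) (x : V → ℝ)
    (h : specRad G * (x ⬝ᵥ x) ≤ x ⬝ᵥ (adjMat G *ᵥ x)) : adjMat G *ᵥ x = specRad G • x := by
  classical
  have hp := psd G
  have h0 := hp.dotProduct_mulVec_nonneg x
  have e : star x ⬝ᵥ ((specRad G • (1 : Matrix V V ℝ) - adjMat G) *ᵥ x) =
      specRad G * (x ⬝ᵥ x) - x ⬝ᵥ (adjMat G *ᵥ x) := by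
    rw [sub_mulVec, smul_mulVec, one_mulVec, dotProduct_sub, dotProduct_smul]
    simp
  have h1 := (hp.dotProduct_mulVec_zero_iff x).1 (by
    rw [e] at h0 ⊢
    linarith)
  rw [sub_mulVec, smul_mulVec, one_mulVec, sub_eq_zero] at h1
  exact h1.symm

lemma form_le [Fintype V] (G : SimpleGraph V) (x : V → ℝ) :
    x ⬝ᵥ (adjMat G *ᵥ x) ≤ specRad G * (x ⬝ᵥ x) := by
  by_contra h
  push Not at h
  have := zero_of_form G x h.le
  rw [this, dotProduct_smul, smul_eq_mul] at h
  exact lt_irrefl _ h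

lemma exists_perron [Fintype V] {G : SimpleGraph V} (hG : G.Connected) : ∃ x, IsPerron G x := by
  classical
  have := hG.nonempty
  obtain ⟨x, hx, hxe⟩ := (eigset_nonempty G).csSup_mem (eigset_finite G)
  change adjMat G *ᵥ x = specRad G • x at hxe
  let y : V → ℝ := fun i => |x i|
  have hy : adjMat G *ᵥ y = specRad G • y := by
    apply zero_of_form
    have e1 : y ⬝ᵥ y = x ⬝ᵥ x := by
      simp [dotProduct, y]
    have e2 : specRad G * (x ⬝ᵥ x) = x ⬝ᵥ (adjMat G *ᵥ x) := by
      rw [hxe, dotProduct_smul, smul_eq_mul]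
    rw [e1, e2]
    simp only [dotProduct, mulVec, Finset.mul_sum]
    refine Finset.sum_le_sum fun i _ => Finset.sum_le_sum fun j _ => ?_
    simp only [adjMat, Matrix.of_apply, y]
    split_ifs
    · rw [one_mul, one_mul, ← abs_mul]; exact le_abs_self _
    · simp
  have hprop : ∀ i j, G.Adj i j → y i = 0 → y j = 0 := by
    intro i j hij hi
    have h := congrFun hy i
    rw [Pi.smul_apply, hi, smul_zero] at h
    simp only [mulVec, dotProduct] at h
    rw [Finset.sum_eq_zero_iff_of_nonneg] at h
    · have := h j (Finset.mem_univ _)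
      simpa [adjMat, hij] using this
    · intro k _
      simp only [adjMat, Matrix.of_apply, y]
      split_ifs <;> simp
  refine ⟨y, ?_, hy⟩
  intro v
  refine lt_of_le_of_ne (abs_nonneg _) ?_
  intro hv
  apply hx
  funext w
  have hr := hG.preconnected v w
  rw [SimpleGraph.reachable_iff_reflTransGen] at hr
  have : y w = 0 := by
    induction hr with
    | refl => exact hv.symm
    | tail _ h ih => exact hprop _ _ h ih
  simpa [y] using this

lemma eq_of_max [Fintype V] {G H : SimpleGraph V} {x : V → ℝ} (hx : IsPerron G x)
    (hle : specRad H ≤ specRad G)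
    (hq : x ⬝ᵥ (adjMat G *ᵥ x) ≤ x ⬝ᵥ (adjMat H *ᵥ x)) : adjMat H *ᵥ x = adjMat G *ᵥ x := by
  by_cases hV : Nonempty V
  · have hxx : 0 < x ⬝ᵥ x := by
      simp only [dotProduct]
      exact Finset.sum_pos (fun i _ => mul_pos (hx.1 i) (hx.1 i)) Finset.univ_nonempty
    have e : x ⬝ᵥ (adjMat G *ᵥ x) = specRad G * (x ⬝ᵥ x) := by
      rw [hx.2, dotProduct_smul, smul_eq_mul]
    have h1 := form_le H x
    have h2 : specRad H = specRad G := by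
      refine le_antisymm hle ?_
      rw [e] at hq
      exact le_of_mul_le_mul_right (hq.trans h1) hxx
    rw [hx.2, ← h2]
    apply zero_of_form
    rw [h2, ← e]; exact hq
  · funext i; exact (hV ⟨i⟩).elim

/-- Symmetric star indicator. -/
noncomputable def st (p : V) (Z : Set V) (a b : V) : ℝ :=
  open Classical in (if a = p ∧ b ∈ Z then 1 else 0) + (if b = p ∧ a ∈ Z then 1 else 0)

/-- Weight of a set. -/
noncomputable def wsum [Fintype V] (x : V → ℝ) (Z : Set V) : ℝ :=
  open Classical in ∑ z, if z ∈ Z then x z else 0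

lemma wsum_nonneg [Fintype V] {x : V → ℝ} (hx : ∀ v, 0 < x v) (Z : Set V) : 0 ≤ wsum x Z := by
  unfold wsum
  refine Finset.sum_nonneg fun z _ => ?_
  split_ifs
  · exact (hx z).le
  · exact le_rfl

lemma wsum_empty [Fintype V] (x : V → ℝ) : wsum x ∅ = 0 := by
  simp [wsum]

lemma wsum_mono [Fintype V] {x : V → ℝ} (hx : ∀ v, 0 < x v) {Z W : Set V} (h : Z ⊆ W) :
    wsum x Z ≤ wsum x W := by
  unfold wsum
  refine Finset.sum_le_sum fun z _ => ?_
  by_cases hz : z ∈ Z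
  · simp [hz, h hz]
  · simp only [hz, if_false]
    split_ifs
    · exact (hx z).le
    · exact le_rfl

lemma wsum_insert [Fintype V] (x : V → ℝ) {Z : Set V} {w : V} (h : w ∉ Z) :
    wsum x (insert w Z) = x w + wsum x Z := by
  classical
  have e : x w = ∑ z, if z = w then x z else 0 := by simp
  unfold wsum
  rw [e, ← Finset.sum_add_distrib]
  refine Finset.sum_congr rfl fun z _ => ?_
  by_cases hz : z = w
  · subst hz; simp [h]
  · by_cases hZ : z ∈ Z <;> simp [hz, hZ]

lemma wsum_pair [Fintype V] (x : V → ℝ) {c t : V} (h : c ≠ t) :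
    wsum x {c, t} = x c + x t := by
  rw [wsum_insert x (by simpa using h), ← insert_empty_eq t, wsum_insert x (by simp), wsum_empty]
  ring

lemma sum_st [Fintype V] (x : V → ℝ) (p : V) (Z : Set V) :
    ∑ a, ∑ b, x a * (st p Z a b * x b) = 2 * (x p * wsum x Z) := by
  classical
  have h1 : ∑ a, ∑ b, x a * ((if a = p ∧ b ∈ Z then (1:ℝ) else 0) * x b) =
      x p * ∑ z, if z ∈ Z then x z else 0 := by
    rw [Finset.sum_eq_single p]
    · rw [Finset.mul_sum]
      refine Finset.sum_congr rfl fun b _ => ?_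
      by_cases hb : b ∈ Z <;> simp [hb]
    · intro a _ ha
      simp [ha]
    · simp
  have h2 : ∑ a, ∑ b, x a * ((if b = p ∧ a ∈ Z then (1:ℝ) else 0) * x b) =
      x p * ∑ z, if z ∈ Z then x z else 0 := by
    rw [Finset.sum_comm, ← h1]
    refine Finset.sum_congr rfl fun b _ => Finset.sum_congr rfl fun a _ => ?_
    ring
  simp only [st, add_mul, mul_add, Finset.sum_add_distrib]
  rw [h1, h2]
  unfold wsum
  ring

lemma form_diff [Fintype V] {G H : SimpleGraph V} (x : V → ℝ) (u v : V) (Z R T : Set V)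
    (h : ∀ a b, adjMat H a b = adjMat G a b + st u Z a b - st v R a b + st v T a b) :
    x ⬝ᵥ (adjMat H *ᵥ x) = x ⬝ᵥ (adjMat G *ᵥ x) +
      2 * (x u * wsum x Z - x v * wsum x R
        + x v * wsum x T) := by
  have e : ∀ M : Matrix V V ℝ, x ⬝ᵥ (M *ᵥ x) = ∑ a, ∑ b, x a * (M a b * x b) := by
    intro M; simp only [dotProduct, mulVec, Finset.mul_sum]
  rw [e, e]
  simp only [h, add_mul, sub_mul, mul_add, mul_sub, Finset.sum_add_distrib, Finset.sum_sub_distrib]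
  rw [sum_st, sum_st, sum_st]
  ring

lemma perron_sum [Fintype V] {G : SimpleGraph V} {x : V → ℝ} (hx : IsPerron G x) (a : V) :
    specRad G * x a = wsum x {b | G.Adj a b} := by
  have := congrFun hx.2 a
  simp only [mulVec, dotProduct, Pi.smul_apply, smul_eq_mul, adjMat, Matrix.of_apply] at this
  rw [← this]
  unfold wsum
  refine Finset.sum_congr rfl fun b _ => ?_
  by_cases h : G.Adj a b <;> simp [h]

/-- If `H` has at least the quadratic form of `G`, and `p` strictly gains neighbours, then the
spectral radius increases. -/
lemma spec_lt [Fintype V] {G H : SimpleGraph V} {x : V → ℝ} (hx : IsPerron G x)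
    (hq : x ⬝ᵥ (adjMat G *ᵥ x) ≤ x ⬝ᵥ (adjMat H *ᵥ x)) (p c : V)
    (hp : ∀ b, G.Adj p b → H.Adj p b) (hc : H.Adj p c) (hc' : ¬ G.Adj p c) :
    specRad G < specRad H := by
  by_contra hcon
  push Not at hcon
  have h := congrFun (eq_of_max hx hcon hq) p
  simp only [mulVec, dotProduct] at h
  have : ∑ b, adjMat G p b * x b < ∑ b, adjMat H p b * x b := by
    refine Finset.sum_lt_sum ?_ ⟨c, Finset.mem_univ _, ?_⟩
    · intro b _
      refine mul_le_mul_of_nonneg_right ?_ (hx.1 b).le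
      simp only [adjMat, Matrix.of_apply]
      by_cases hb : G.Adj p b
      · simp [hb, hp b hb]
      · simp only [hb, if_false]; split_ifs <;> simp
    · simp [adjMat, hc, hc', hx.1 c]
  linarith

lemma form_mono [Fintype V] {G H : SimpleGraph V} {x : V → ℝ} (hx : ∀ v, 0 < x v) (h : G ≤ H) :
    x ⬝ᵥ (adjMat G *ᵥ x) ≤ x ⬝ᵥ (adjMat H *ᵥ x) := by
  simp only [dotProduct, mulVec, Finset.mul_sum]
  refine Finset.sum_le_sum fun a _ => Finset.sum_le_sum fun b _ => ?_
  refine mul_le_mul_of_nonneg_left (mul_le_mul_of_nonneg_right ?_ (hx b).le) (hx a).le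
  simp only [adjMat, Matrix.of_apply]
  by_cases hb : G.Adj a b
  · simp [hb, h hb]
  · simp only [hb, if_false]; split_ifs <;> simp

end Part3

section Part4
open Matrix

lemma isDissoc_iff [Finite V] {G : SimpleGraph V} {D : Set V} : IsDissoc G D ↔
    ∀ v ∈ D, ∀ a ∈ D, ∀ b ∈ D, G.Adj v a → G.Adj v b → a = b := by
  unfold IsDissoc
  refine forall₂_congr fun v _ => ?_
  rw [Set.ncard_le_one (Set.toFinite _)]
  constructor
  · intro h a ha b hb h1 h2
    exact h a ⟨ha, h1⟩ b ⟨hb, h2⟩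
  · rintro h a ⟨ha, h1⟩ b ⟨hb, h2⟩
    exact h a ha b hb h1 h2

lemma dissoc_bdd [Fintype V] (G : SimpleGraph V) :
    BddAbove {n : ℕ | ∃ D : Set V, IsDissoc G D ∧ D.ncard = n} := by
  refine ⟨Nat.card V, ?_⟩
  rintro n ⟨D, -, rfl⟩
  exact Set.ncard_le_card D

lemma le_dissocNum [Fintype V] {G : SimpleGraph V} {D : Set V} (h : IsDissoc G D) :
    D.ncard ≤ dissocNum G := le_csSup (dissoc_bdd G) ⟨D, h, rfl⟩

lemma exists_maxDissoc [Fintype V] (G : SimpleGraph V) : ∃ D, IsMaxDissoc G D := by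
  have : {n : ℕ | ∃ D : Set V, IsDissoc G D ∧ D.ncard = n}.Nonempty :=
    ⟨0, ∅, by intro v hv; exact absurd hv (Set.notMem_empty v), by simp⟩
  exact Nat.sSup_mem this (dissoc_bdd G)

lemma dissocNum_eq [Fintype V] {H : SimpleGraph V} {n : ℕ}
    (h1 : ∃ D, IsDissoc H D ∧ D.ncard = n) (h2 : ∀ D, IsDissoc H D → D.ncard ≤ n) :
    dissocNum H = n := by
  obtain ⟨D, hD, rfl⟩ := h1
  refine le_antisymm ?_ (le_dissocNum hD)
  obtain ⟨E, hE, hE'⟩ := exists_maxDissoc H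
  rw [← hE']; exact h2 E hE

lemma dissoc_of_edges [Finite V] {G H : SimpleGraph V} {D : Set V}
    (h : ∀ a ∈ D, ∀ b ∈ D, G.Adj a b → H.Adj a b) (hD : IsDissoc H D) : IsDissoc G D := by
  rw [isDissoc_iff] at hD ⊢
  intro v hv a ha b hb h1 h2
  exact hD v hv a ha b hb (h v hv a ha h1) (h v hv b hb h2)

/-- Extremal block graph. -/
def Ext [Fintype V] (G : SimpleGraph V) : Prop :=
  G.Connected ∧ Star G ∧ ∀ H : SimpleGraph V, H.Connected → Star H →
    dissocNum H = dissocNum G → specRad H ≤ specRad G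

lemma merge_false [Fintype V] {G : SimpleGraph V} (hG : Ext G) {B C : Set V} (hB : Blk G B)
    (hC : Blk G C) {u b c : V} (huB : u ∈ B) (huC : u ∈ C) (hb : b ∈ B) (hbu : b ≠ u)
    (hc : c ∈ C) (hcB : c ∉ B) {D : Set V} (hD : IsMaxDissoc G D)
    (hD' : IsDissoc (mergeG G B C) D) : False := by
  obtain ⟨x, hx⟩ := exists_perron hG.1
  have hle := hG.2.2 (mergeG G B C) (merge_connected hG.1 B C) (merge_star hG.2.1 hB hC huB huC)
    (dissocNum_eq ⟨D, hD', hD.2⟩ (fun E hE => le_dissocNum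
      (dissoc_of_edges (fun a _ b _ h => merge_le G B C h) hE)))
  refine absurd (spec_lt hx (form_mono hx.1 (merge_le G B C)) b c
    (fun z hz => merge_le G B C hz) ⟨?_, Or.inr ⟨Or.inl hb, Or.inr hc⟩⟩ ?_) (not_lt.2 hle)
  · rintro rfl; exact hcB hb
  · intro hbc
    have hcu : c ≠ u := by rintro rfl; exact hcB huB
    exact hcB (hB.2 c b hb u huB hbu hbc.symm (hC.1 c hc u huC hcu))

lemma edgeBlk_inter {G : SimpleGraph V} {B : Set V} (hB : Blk G B) {u c p : V} (huB : u ∈ B)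
    (hcB : c ∉ B) (huc : G.Adj u c) (hp : p ∈ B) (hpC : p ∈ edgeBlk G u c) : p = u := by
  rcases hpC with h | h | h
  · exact h
  · subst h; exact absurd hp hcB
  · exact absurd (hB.2 c u huB p hp h.1.ne' huc.symm h.2.symm) hcB

lemma F1 [Fintype V] {G : SimpleGraph V} (hG : Ext G) {B : Set V} (hB : Blk G B)
    {u b c : V} (huB : u ∈ B) (hb : b ∈ B) (hbu : b ≠ u) (huc : G.Adj u c) (hcB : c ∉ B)
    {D : Set V} (hD : IsMaxDissoc G D) : ∃ p ∈ D, p ∈ B ∧ p ≠ u := by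
  by_contra hcon
  push Not at hcon
  refine merge_false hG hB (blk_edgeBlk hG.2.1 huc) huB (Or.inl rfl) hb hbu (Or.inr (Or.inl rfl))
    hcB hD (dissoc_of_edges (H := G) ?_ hD.1)
  rintro p hp q hq ⟨hne, h | ⟨h1, h2⟩⟩
  · exact h
  · have hC := blk_edgeBlk hG.2.1 huc
    have key : ∀ p ∈ D, p ∈ B ∪ edgeBlk G u c → p ∈ edgeBlk G u c := by
      rintro p hp (h | h)
      · rw [hcon p hp h]; exact Or.inl rfl
      · exact h
    exact hC.1 p (key p hp h1) q (key q hq h2) hne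

lemma shift_upper [Fintype V] {G : SimpleGraph V} {u v : V} {Q : Set V} (huv : G.Adj u v)
    (hu : u ∈ Q)
    (hbad : ∀ D', v ∈ D' → u ∉ D' → IsDissoc (shiftG G u v Q) D' → IsMaxDissoc G (D' \ {v}) → False) :
    ∀ D', IsDissoc (shiftG G u v Q) D' → D'.ncard ≤ dissocNum G := by
  intro D' hD'
  have hgen : ∀ a b, a ≠ v → b ≠ v → G.Adj a b → (shiftG G u v Q).Adj a b :=
    fun a b ha hb h => ⟨h.ne, Or.inl ⟨ha, hb, Or.inl h⟩⟩
  by_cases hv : v ∈ D'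
  · by_cases huD : u ∈ D'
    · refine le_dissocNum (dissoc_of_edges (H := shiftG G u v Q) ?_ hD')
      have hvadj : ∀ q ∈ D', G.Adj v q → q = u := by
        intro q hq hvq
        by_contra hqu
        have h1 : (shiftG G u v Q).Adj u q :=
          ⟨Ne.symm hqu, Or.inl ⟨huv.ne, hvq.ne', Or.inr (Or.inl ⟨rfl, hvq⟩)⟩⟩
        have h2 : (shiftG G u v Q).Adj u v := ⟨huv.ne, Or.inr (Or.inr ⟨rfl, hu⟩)⟩
        exact hvq.ne (isDissoc_iff.1 hD' u huD v hv q hq h2 h1)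
      have h2 : (shiftG G u v Q).Adj u v := ⟨huv.ne, Or.inr (Or.inr ⟨rfl, hu⟩)⟩
      intro a ha b hb hab
      by_cases hav : a = v
      · subst hav; rw [hvadj b hb hab]; exact h2.symm
      by_cases hbv : b = v
      · subst hbv; rw [hvadj a ha hab.symm]; exact h2
      exact hgen a b hav hbv hab
    · by_contra hcon
      push Not at hcon
      have hd : IsDissoc G (D' \ {v}) := by
        refine dissoc_of_edges (H := shiftG G u v Q) (fun a ha b hb h => hgen a b ha.2 hb.2 h) ?_
        rw [isDissoc_iff] at hD' ⊢
        intro p hp a ha b hb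
        exact hD' p hp.1 a ha.1 b hb.1
      have h1 := le_dissocNum hd
      have h2 := Set.ncard_sdiff_singleton_add_one hv (Set.toFinite _)
      exact hbad D' hv huD hD' ⟨hd, by omega⟩
  · refine le_dissocNum (dissoc_of_edges (H := shiftG G u v Q) ?_ hD')
    intro a ha b hb hab
    exact hgen a b (by rintro rfl; exact hv ha) (by rintro rfl; exact hv hb) hab

lemma shift_adjMat [Fintype V] {G : SimpleGraph V} {u v : V} {Q : Set V} (huv : u ≠ v)
    (hvQ : v ∉ Q) (a b : V) :
    adjMat (shiftG G u v Q) a b = adjMat G a b +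
      st u {z | G.Adj v z ∧ z ≠ u ∧ ¬ G.Adj u z} a b - st v {z | G.Adj v z ∧ z ∉ Q} a b
      + st v {z | z ∈ Q ∧ ¬ G.Adj v z} a b := by
  classical
  have hs : ∀ p q, G.Adj p q ↔ G.Adj q p := fun p q => G.adj_comm p q
  have hl : ∀ p, ¬ G.Adj p p := fun p => G.loopless.irrefl p
  simp only [adjMat, st, shiftG, Matrix.of_apply, Set.mem_ofPred_eq]
  by_cases hav : a = v
  · subst hav
    by_cases hbv : b = a
    · subst hbv; simp [huv.symm, hl, hvQ]
    · by_cases hbQ : b ∈ Q <;> by_cases hab : G.Adj a b <;> simp [huv.symm, hbv, Ne.symm hbv, hbQ, hab, hl]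
  · by_cases hbv : b = v
    · subst hbv
      have hh := hs a b
      by_cases haQ : a ∈ Q <;> by_cases hab : G.Adj b a <;> simp only [hab, iff_true, iff_false] at hh <;>
        simp [huv.symm, hav, Ne.symm hav, haQ, hab, hh, hl]
    · by_cases hau : a = u
      · subst hau
        by_cases hbu : b = a
        · subst hbu; simp [hl, hav]
        · by_cases h1 : G.Adj a b <;> by_cases h2 : G.Adj v b <;>
            simp [hav, hbv, hbu, Ne.symm hbu, h1, h2, hl]
      · by_cases hbu : b = u
        · subst hbu
          have hh := hs a b
          by_cases h1 : G.Adj b a <;> by_cases h2 : G.Adj v a <;>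
            simp only [h1, iff_true, iff_false] at hh <;>
            simp [hav, hbv, hau, Ne.symm hau, h1, h2, hh, hl]
        · by_cases h1 : G.Adj a b
          · simp [hav, hbv, hau, hbu, h1, h1.ne]
          · simp [hav, hbv, hau, hbu, h1]

/-- Combined shift contradiction. -/
lemma shift_false [Fintype V] {G : SimpleGraph V} (hG : Ext G) {u v z0 : V} {C : Set V}
    (hC : Blk G C) (huC : u ∈ C) (huv : G.Adj u v) (hvz : G.Adj v z0) (hz0 : z0 ≠ u)
    (huz : ¬ G.Adj u z0) {x : V → ℝ} (hx : IsPerron G x)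
    (hform : x ⬝ᵥ (adjMat G *ᵥ x) ≤ x ⬝ᵥ (adjMat (shiftG G u v (C \ {v})) *ᵥ x))
    (hlow : ∃ D, IsDissoc (shiftG G u v (C \ {v})) D ∧ D.ncard = dissocNum G)
    (hbad : ∀ D', v ∈ D' → u ∉ D' → IsDissoc (shiftG G u v (C \ {v})) D' →
      IsMaxDissoc G (D' \ {v}) → False) : False := by
  have hQ := contr_Q hG.2.1 hC huC huv
  have huQ : u ∈ C \ {v} := ⟨huC, huv.ne⟩
  have hle := hG.2.2 _ (shift_connected hG.1 huv huQ)
    (shift_star hG.2.1 huv (by simp) hQ.1 hQ.2)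
    (dissocNum_eq hlow (shift_upper huv huQ hbad))
  refine absurd (spec_lt hx hform u z0 ?_ ⟨Ne.symm hz0, Or.inl ⟨huv.ne, hvz.ne', Or.inr (Or.inl ⟨rfl, hvz⟩)⟩⟩
    huz) (not_lt.2 hle)
  intro b hb
  by_cases hbv : b = v
  · subst hbv; exact ⟨hb.ne, Or.inr (Or.inr ⟨rfl, huQ⟩)⟩
  · exact ⟨hb.ne, Or.inl ⟨huv.ne, hbv, Or.inl hb⟩⟩

/-- All maximum dissociation sets meet `B` in at least two vertices. -/
def Two [Fintype V] (G : SimpleGraph V) (B : Set V) : Prop :=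
  ∀ D, IsMaxDissoc G D → ∃ p ∈ D, ∃ q ∈ D, p ∈ B ∧ q ∈ B ∧ p ≠ q

lemma shift_S [Fintype V] {G : SimpleGraph V} (hG : Ext G) {B : Set V} (hB : Blk G B)
    {u v z0 : V} (hu : u ∈ B) (hv : v ∈ B) (huv : u ≠ v) (hvz : G.Adj v z0) (hz0 : z0 ∉ B)
    {x : V → ℝ} (hx : IsPerron G x) (hxuv : x v ≤ x u) (hT : Two G B)
    (hlow : ∃ D, IsDissoc (shiftG G u v (B \ {v})) D ∧ D.ncard = dissocNum G) : False := by
  classical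
  have hadj := hB.1 u hu v hv huv
  refine shift_false hG hB hu hadj hvz (by rintro rfl; exact hz0 hu) ?_ hx ?_ hlow ?_
  · intro h
    exact hz0 (hB.2 z0 u hu v hv huv h.symm hvz.symm)
  · rw [form_diff x u v _ _ _ (shift_adjMat huv (by simp))]
    have e1 : {z | G.Adj v z ∧ z ∉ B \ {v}} = {z | G.Adj v z ∧ z ≠ u ∧ ¬ G.Adj u z} := by
      ext z
      simp only [Set.mem_ofPred_eq, Set.mem_sdiff, Set.mem_singleton_iff, not_and, not_not]
      constructor
      · rintro ⟨h1, h2⟩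
        refine ⟨h1, ?_, ?_⟩
        · rintro rfl; exact huv (h2 hu)
        · intro h
          exact h1.ne' (h2 (hB.2 z u hu v hv huv h.symm h1.symm))
      · rintro ⟨h1, h2, h3⟩
        refine ⟨h1, fun h => ?_⟩
        exact absurd (hB.1 u hu z h (Ne.symm h2)) h3
    have e2 : {z | z ∈ B \ {v} ∧ ¬ G.Adj v z} = ∅ := by
      ext z
      simp only [Set.mem_ofPred_eq, Set.mem_sdiff, Set.mem_singleton_iff, Set.mem_empty_iff_false,
        iff_false, not_and, not_not, and_imp]
      intro h1 h2
      exact hB.1 v hv z h1 (Ne.symm h2)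
    rw [e1, e2]
    have hS := wsum_nonneg hx.1 {z | G.Adj v z ∧ z ≠ u ∧ ¬ G.Adj u z}
    rw [wsum_empty]
    nlinarith [mul_le_mul_of_nonneg_right hxuv hS]
  · intro D' hvD huD hD' hmax
    obtain ⟨p, hp, q, hq, hpB, hqB, hpq⟩ := hT _ hmax
    refine hpq (isDissoc_iff.1 hD' v hvD p hp.1 q hq.1 ?_ ?_)
    · exact ⟨Ne.symm hp.2, Or.inr (Or.inl ⟨rfl, hpB, hp.2⟩)⟩
    · exact ⟨Ne.symm hq.2, Or.inr (Or.inl ⟨rfl, hqB, hq.2⟩)⟩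

/-- If `v` lies in a dissociation set meeting `B` twice, the set survives the shift. -/
lemma low_of_mem [Fintype V] {G : SimpleGraph V} {B : Set V} (hB : Blk G B)
    {u v : V} (hu : u ∈ B) (hv : v ∈ B) (huv : u ≠ v) {D : Set V} (hD : IsDissoc G D)
    (hvD : v ∈ D) : IsDissoc (shiftG G u v (B \ {v})) D := by
  refine dissoc_of_edges (H := G) ?_ hD
  rw [isDissoc_iff] at hD
  rintro a ha b hb ⟨hab, ⟨h1, h2, h | ⟨rfl, h⟩ | ⟨rfl, h⟩⟩ | ⟨rfl, h⟩ | ⟨rfl, h⟩⟩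
  · exact h
  · have hav := hB.1 a hu v hv huv
    exact absurd (hD v hvD a ha b hb hav.symm h) hab
  · have hbv := hB.1 b hu v hv huv
    exact absurd (hD v hvD a ha b hb h hbv.symm) hab
  · exact hB.1 a hv b h.1 hab
  · exact hB.1 a h.1 b hv hab

lemma S1 [Fintype V] {G : SimpleGraph V} (hG : Ext G) {B : Set V} (hB : Blk G B)
    {u v c d : V} (hu : u ∈ B) (hv : v ∈ B) (huv : u ≠ v) (huc : G.Adj u c) (hc : c ∉ B)
    (hvd : G.Adj v d) (hd : d ∉ B) (hT : Two G B) {D : Set V} (hD : IsMaxDissoc G D)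
    (huD : u ∈ D) (hvD : v ∈ D) : False := by
  obtain ⟨x, hx⟩ := exists_perron hG.1
  rcases le_total (x v) (x u) with h | h
  · exact shift_S hG hB hu hv huv hvd hd hx h hT ⟨D, low_of_mem hB hu hv huv hD.1 hvD, hD.2⟩
  · exact shift_S hG hB hv hu huv.symm huc hc hx h hT
      ⟨D, low_of_mem hB hv hu huv.symm hD.1 huD, hD.2⟩

lemma K2 [Fintype V] {G : SimpleGraph V} (hG : Ext G) {B : Set V} (hB : Blk G B)
    {u v c d : V} (hu : u ∈ B) (hv : v ∈ B) (huv : u ≠ v) (huc : G.Adj u c) (hc : c ∉ B)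
    (hvd : G.Adj v d) (hd : d ∉ B) (hall : ∀ z ∈ B, z = u ∨ z = v) : False := by
  have key : ∀ D, IsMaxDissoc G D → u ∈ D ∧ v ∈ D := by
    intro D hD
    obtain ⟨p, hp, hpB, hpu⟩ := F1 hG hB hu hv huv.symm huc hc hD
    obtain ⟨q, hq, hqB, hqv⟩ := F1 hG hB hv hu huv hvd hd hD
    rw [(hall p hpB).resolve_left hpu] at hp
    rw [(hall q hqB).resolve_right hqv] at hq
    exact ⟨hq, hp⟩
  obtain ⟨D, hD⟩ := exists_maxDissoc G
  exact S1 hG hB hu hv huv huc hc hvd hd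
    (fun E hE => ⟨u, (key E hE).1, v, (key E hE).2, hu, hv, huv⟩) hD (key D hD).1 (key D hD).2

/-- The merge survives if `D` meets `B` only in `w`, `w` isolated in `D`, and `D` meets the other
block in at most one vertex, isolated. -/
lemma merge_survive [Fintype V] {G : SimpleGraph V} {B C : Set V} {w : V} {D : Set V}
    (hD : IsDissoc G D) (hDB : ∀ p ∈ D, p ∈ B → p = w)
    (hw : ∀ p ∈ D, ¬ G.Adj w p)
    (hC1 : ∀ p ∈ D, ∀ q ∈ D, p ∈ C → q ∈ C → p = q)
    (hC2 : ∀ p ∈ D, p ∈ C → ∀ q ∈ D, ¬ G.Adj p q) : IsDissoc (mergeG G B C) D := by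
  have iso : ∀ p ∈ D, p ∈ B ∪ C → ∀ q ∈ D, ¬ G.Adj p q := by
    rintro p hp (h | h) q hq
    · rw [hDB p hp h]; exact hw q hq
    · exact hC2 p hp h q hq
  rw [isDissoc_iff] at hD ⊢
  rintro v hv a ha b hb ⟨hva, h1⟩ ⟨hvb, h2⟩
  rcases h1 with h1 | ⟨h1, h1'⟩
  · rcases h2 with h2 | ⟨h2, h2'⟩
    · exact hD v hv a ha b hb h1 h2
    · exact absurd h1 (iso v hv h2 a ha)
  · rcases h2 with h2 | ⟨h2, h2'⟩
    · exact absurd h2 (iso v hv h1 b hb)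
    · rcases h1 with h | h <;> rcases h1' with h' | h' <;> rcases h2' with h'' | h''
      · rw [hDB a ha h', hDB b hb h'']
      · exact absurd ((hDB v hv h).trans (hDB a ha h').symm) hva
      · exact absurd ((hDB v hv h).trans (hDB b hb h'').symm) hvb
      · exact hC1 a ha b hb h' h''
      · rw [hDB a ha h', hDB b hb h'']
      · exact absurd (hC1 v hv b hb h h'') hvb
      · exact absurd (hC1 v hv a ha h h') hva
      · exact absurd (hC1 v hv a ha h h') hva

end Part4

section Part5
open Matrix

lemma wsum_mem [Fintype V] {x : V → ℝ} (hx : ∀ v, 0 < x v) {Z : Set V} {a : V} (h : a ∈ Z) :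
    x a ≤ wsum x Z := by
  have h1 : wsum x {a} ≤ wsum x Z := wsum_mono hx (by simpa using h)
  rw [← insert_empty_eq a, wsum_insert x (by simp), wsum_empty] at h1
  linarith

lemma low_swap [Fintype V] {G : SimpleGraph V} {B : Set V} {u v w : V}
    (huw : u ≠ w) (hvw : v ≠ w)
    (hall : ∀ z ∈ B, z = u ∨ z = v ∨ z = w) (hwin : ∀ z, G.Adj w z → z ∈ B)
    {D : Set V} (hD : IsDissoc G D) (huD : u ∈ D) (hvD : v ∉ D) :
    IsDissoc (shiftG G u v (B \ {v})) (insert v (D \ {u})) ∧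
      (insert v (D \ {u})).ncard = D.ncard := by
  constructor
  · rw [isDissoc_iff] at hD ⊢
    have huv : u ≠ v := by rintro rfl; exact hvD huD
    have hnu : ∀ p ∈ insert v (D \ {u}), p ≠ u := by
      rintro p (rfl | h)
      · exact huv.symm
      · exact h.2
    have hDm : ∀ p ∈ insert v (D \ {u}), p ≠ v → p ∈ D := by
      rintro p (rfl | h) h'
      · exact absurd rfl h'
      · exact h.1
    have hvadj : ∀ p ∈ insert v (D \ {u}), (shiftG G u v (B \ {v})).Adj v p → p = w := by
      rintro p hp ⟨h0, ⟨h1, -⟩ | ⟨-, h⟩ | ⟨h, -⟩⟩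
      · exact absurd rfl h1
      · rcases hall p h.1 with e | e | e
        · exact absurd e (hnu p hp)
        · exact absurd e.symm h0
        · exact e
      · exact absurd h.symm h0
    have hgen : ∀ p ∈ insert v (D \ {u}), ∀ q ∈ insert v (D \ {u}), p ≠ v → q ≠ v →
        (shiftG G u v (B \ {v})).Adj p q → G.Adj p q := by
      rintro p hp q hq hpv hqv ⟨h0, ⟨h1, h2, h | ⟨h, -⟩ | ⟨h, -⟩⟩ | ⟨h, -⟩ | ⟨h, -⟩⟩
      · exact h
      · exact absurd h (hnu p hp)
      · exact absurd h (hnu q hq)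
      · exact absurd h hpv
      · exact absurd h hqv
    have hwadj : ∀ p ∈ insert v (D \ {u}), (shiftG G u v (B \ {v})).Adj w p → p = v := by
      intro p hp h
      by_contra hpv
      have hg : G.Adj w p := by
        rcases h with ⟨h0, ⟨h1, h2, h | ⟨h, -⟩ | ⟨h, -⟩⟩ | ⟨h, -⟩ | ⟨h, -⟩⟩
        · exact h
        · exact absurd h.symm huw
        · exact absurd h (hnu p hp)
        · exact absurd h.symm hvw
        · exact absurd h hpv
      rcases hall p (hwin p hg) with e | e | e
      · exact hnu p hp e
      · exact hpv e
      · exact hg.ne e.symm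
    intro p hp a ha b hb h1 h2
    by_cases hpv : p = v
    · subst hpv
      rw [hvadj a ha h1, hvadj b hb h2]
    · by_cases hav : a = v
      · have hpw : p = w := hvadj p hp (by rw [hav] at h1; exact h1.symm)
        rw [hpw] at h2
        rw [hav, hwadj b hb h2]
      · by_cases hbv : b = v
        · have hpw : p = w := hvadj p hp (by rw [hbv] at h2; exact h2.symm)
          rw [hpw] at h1
          rw [hbv, hwadj a ha h1]
        · exact hD p (hDm p hp hpv) a (hDm a ha hav) b (hDm b hb hbv) (hgen p hp a ha hpv hav h1)
            (hgen p hp b hb hpv hbv h2)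
  · exact Set.ncard_exchange hvD huD

lemma K3_two [Fintype V] {G : SimpleGraph V} (hG : Ext G) {B : Set V} (hB : Blk G B)
    {u v w d : V} (hu : u ∈ B) (hv : v ∈ B) (huv : u ≠ v) (huw : u ≠ w) (hvw : v ≠ w)
    (hall : ∀ z ∈ B, z = u ∨ z = v ∨ z = w) (hwin : ∀ z, G.Adj w z → z ∈ B)
    (hvd : G.Adj v d) (hd : d ∉ B) (hT : Two G B) {x : V → ℝ} (hx : IsPerron G x)
    (hxuv : x v ≤ x u) : False := by
  obtain ⟨D, hD⟩ := exists_maxDissoc G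
  by_cases hvD : v ∈ D
  · exact shift_S hG hB hu hv huv hvd hd hx hxuv hT
      ⟨D, low_of_mem hB hu hv huv hD.1 hvD, hD.2⟩
  · have huD : u ∈ D := by
      obtain ⟨p, hp, q, hq, hpB, hqB, hpq⟩ := hT D hD
      rcases hall p hpB with rfl | rfl | rfl
      · exact hp
      · exact absurd hp hvD
      · rcases hall q hqB with rfl | rfl | rfl
        · exact hq
        · exact absurd hq hvD
        · exact absurd rfl hpq
    have h := low_swap huw hvw hall hwin hD.1 huD hvD
    exact shift_S hG hB hu hv huv hvd hd hx hxuv hT ⟨_, h.1, h.2.trans hD.2⟩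

lemma K3_one [Fintype V] {G : SimpleGraph V} (hG : Ext G) {B : Set V} (hB : Blk G B)
    {u v w c d : V} (hu : u ∈ B) (hv : v ∈ B) (hw : w ∈ B) (huv : u ≠ v) (huw : u ≠ w)
    (hvw : v ≠ w)
    (hall : ∀ z ∈ B, z = u ∨ z = v ∨ z = w) (hwin : ∀ z, G.Adj w z → z ∈ B)
    (huc : G.Adj u c) (hc : c ∉ B)
    (hvd : G.Adj v d) (hd : d ∉ B) {D : Set V} (hD : IsMaxDissoc G D)
    (hDB : ∀ p ∈ D, p ∈ B → p = w) {x : V → ℝ} (hx : IsPerron G x)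
    (hxuv : x v ≤ x u) : False := by
  have hC := blk_edgeBlk hG.2.1 huc
  set C := edgeBlk G u c with hCdef
  have huC : u ∈ C := Or.inl rfl
  have hcC : c ∈ C := Or.inr (Or.inl rfl)
  have hBC : ∀ p, p ∈ B → p ∈ C → p = u := fun p hp hpC => edgeBlk_inter hB hu hc huc hp hpC
  have hvC : v ∉ C := fun h => huv (hBC v hv h).symm
  have hwC : w ∉ C := fun h => huw (hBC w hw h).symm
  have hadj : G.Adj u v := hB.1 u hu v hv huv
  have hcu : c ≠ u := huc.ne'
  have hmerge : ∀ E, IsMaxDissoc G E → (∀ p ∈ E, p ∈ B → p = w) →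
      (∀ p ∈ E, ∀ q ∈ E, p ∈ C → q ∈ C → p = q) →
      (∀ p ∈ E, p ∈ C → ∀ q ∈ E, ¬ G.Adj p q) → False := by
    intro E hE hEB h1 h2
    refine merge_false hG hB hC hu huC hv huv.symm hcC hc hE
      (merge_survive hE.1 hEB ?_ h1 h2)
    intro p hp hwp
    exact hwp.ne (hEB p hp (hwin p hwp)).symm
  have huD : u ∉ D := fun h => huw (hDB u h hu)
  have hvD : v ∉ D := fun h => hvw (hDB v h hv)
  obtain ⟨t, htC, htu, htc⟩ : ∃ t ∈ C, t ≠ u ∧ t ≠ c := by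
    by_contra hcon
    push Not at hcon
    have hDC : ∀ p ∈ D, p ∈ C → p = c := fun p hp hpC =>
      hcon p hpC (by rintro rfl; exact huD hp)
    refine hmerge D hD hDB (fun p hp q hq h1 h2 => (hDC p hp h1).trans (hDC q hq h2).symm) ?_
    intro p hp hpC q hq hpq
    have hpc := hDC p hp hpC
    subst hpc
    have hqC : q ∉ C := fun h => hpq.ne (hDC q hq h).symm
    refine K2 hG hC huC hcC huc.ne hadj hvC hpq hqC ?_
    intro z hz
    by_cases h : z = u
    · exact Or.inl h
    · exact Or.inr (hcon z hz h)
  have hCv : C \ {v} = C := by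
    ext z
    constructor
    · exact fun h => h.1
    · intro h
      refine ⟨h, ?_⟩
      rintro rfl
      exact hvC h
  have hvC' : ∀ z ∈ C, z ≠ u → ¬ G.Adj v z := by
    intro z hz hzu h
    exact hvC (hC.2 v z hz u huC hzu h hadj.symm)
  refine shift_false hG hC huC hadj hvd (by rintro rfl; exact hd hu) ?_ hx ?_ ?_ ?_
  · intro h
    exact hd (hB.2 d u hu v hv huv h.symm hvd.symm)
  · rw [hCv, form_diff x u v _ _ _ (shift_adjMat huv hvC)]
    set Z : Set V := {z | G.Adj v z ∧ z ≠ u ∧ ¬ G.Adj u z} with hZ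
    have hwZ : w ∉ Z := fun h => h.2.2 (hB.1 u hu w hw huw)
    have e1 : {z | G.Adj v z ∧ z ∉ C} = insert w Z := by
      ext z
      constructor
      · rintro ⟨h1, h2⟩
        by_cases hzw : z = w
        · exact Or.inl hzw
        · right
          refine ⟨h1, ?_, ?_⟩
          · rintro rfl; exact h2 huC
          · intro h
            have hzB := hB.2 z u hu v hv huv h.symm h1.symm
            rcases hall z hzB with e | e | e
            · exact h.ne e.symm
            · exact h1.ne e.symm
            · exact hzw e
      · rintro (rfl | ⟨h1, h2, h3⟩)
        · exact ⟨hB.1 v hv z hw hvw, hwC⟩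
        · exact ⟨h1, fun h => hvC' z h h2 h1⟩
    rw [e1, wsum_insert x hwZ]
    have hS := wsum_nonneg hx.1 Z
    have hT : x c + x t ≤ wsum x {z | z ∈ C ∧ ¬ G.Adj v z} := by
      rw [← wsum_pair x (Ne.symm htc)]
      refine wsum_mono hx.1 ?_
      rintro z (rfl | rfl)
      · exact ⟨hcC, hvC' _ hcC hcu⟩
      · exact ⟨htC, hvC' _ htC htu⟩
    have hρw : specRad G * x w = x u + x v := by
      rw [perron_sum hx w, ← wsum_pair x huv]
      congr 1
      ext z
      constructor
      · intro h
        rcases hall z (hwin z h) with e | e | e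
        · exact Or.inl e
        · exact Or.inr e
        · exact absurd e.symm (G.ne_of_adj h)
      · rintro (rfl | rfl)
        · exact hB.1 w hw _ hu huw.symm
        · exact hB.1 w hw _ hv hvw.symm
    have hρc : x u ≤ specRad G * x c := by
      rw [perron_sum hx c]
      exact wsum_mem hx.1 huc.symm
    have hρt : x u ≤ specRad G * x t := by
      rw [perron_sum hx t]
      exact wsum_mem hx.1 (hC.1 t htC u huC htu)
    have hρ : 0 < specRad G := by
      have := hx.1 u
      exact pos_of_mul_pos_left (lt_of_lt_of_le this hρc) (hx.1 c).le
    have hwct : x w ≤ x c + x t := by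
      refine le_of_mul_le_mul_left ?_ hρ
      rw [mul_add]
      linarith
    have h1 := mul_le_mul_of_nonneg_right hxuv hS
    have h2 := mul_le_mul_of_nonneg_left (hwct.trans hT) (hx.1 v).le
    linarith
  · refine ⟨D, dissoc_of_edges (H := G) ?_ hD.1, hD.2⟩
    rintro a ha b hb ⟨h0, ⟨h1, h2, h | ⟨h, -⟩ | ⟨h, -⟩⟩ | ⟨h, -⟩ | ⟨h, -⟩⟩
    · exact h
    · subst h; exact absurd ha huD
    · subst h; exact absurd hb huD
    · subst h; exact absurd ha hvD
    · subst h; exact absurd hb hvD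
  · rw [hCv]
    intro D' hvD' huD' hD' hmax
    rw [isDissoc_iff] at hD'
    have hvadj : ∀ z ∈ C, (shiftG G u v C).Adj v z := by
      intro z hz
      exact ⟨by rintro rfl; exact hvC hz, Or.inr (Or.inl ⟨rfl, hz⟩)⟩
    refine hmerge _ hmax ?_ ?_ ?_
    · intro p hp hpB
      rcases hall p hpB with e | e | e
      · subst e; exact absurd hp.1 huD'
      · exact absurd e hp.2
      · exact e
    · intro p hp q hq hpC hqC
      exact hD' v hvD' p hp.1 q hq.1 (hvadj p hpC) (hvadj q hqC)
    · intro p hp hpC q hq hpq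
      have h1 : (shiftG G u v C).Adj p q := ⟨hpq.ne, Or.inl ⟨hp.2, hq.2, Or.inl hpq⟩⟩
      exact hq.2 (hD' p hp.1 q hq.1 v hvD' h1 (hvadj p hpC).symm)

lemma K3 [Fintype V] {G : SimpleGraph V} (hG : Ext G) {B : Set V} (hB : Blk G B)
    {u v w c d : V} (hu : u ∈ B) (hv : v ∈ B) (hw : w ∈ B) (huv : u ≠ v) (huw : u ≠ w)
    (hvw : v ≠ w)
    (hall : ∀ z ∈ B, z = u ∨ z = v ∨ z = w)
    (huc : G.Adj u c) (hc : c ∉ B) (hvd : G.Adj v d) (hd : d ∉ B) : False := by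
  have hall' : ∀ z ∈ B, z = v ∨ z = u ∨ z = w := by
    intro z hz
    rcases hall z hz with h | h | h
    · exact Or.inr (Or.inl h)
    · exact Or.inl h
    · exact Or.inr (Or.inr h)
  obtain ⟨x, hx⟩ := exists_perron hG.1
  by_cases hT : Two G B
  · by_cases hwin : ∀ z, G.Adj w z → z ∈ B
    · rcases le_total (x v) (x u) with h | h
      · exact K3_two hG hB hu hv huv huw hvw hall hwin hvd hd hT hx h
      · exact K3_two hG hB hv hu huv.symm hvw huw hall' hwin huc hc hT hx h
    · push Not at hwin
      obtain ⟨e, hwe, he⟩ := hwin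
      have hout : ∀ z ∈ B, ∃ y, G.Adj z y ∧ y ∉ B := by
        intro z hz
        rcases hall z hz with rfl | rfl | rfl
        · exact ⟨c, huc, hc⟩
        · exact ⟨d, hvd, hd⟩
        · exact ⟨e, hwe, he⟩
      obtain ⟨D, hD⟩ := exists_maxDissoc G
      obtain ⟨p, hp, q, hq, hpB, hqB, hpq⟩ := hT D hD
      obtain ⟨y, hy, hyB⟩ := hout p hpB
      obtain ⟨y', hy', hyB'⟩ := hout q hqB
      exact S1 hG hB hpB hqB hpq hy hyB hy' hyB' hT hD hp hq
  · unfold Two at hT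
    push Not at hT
    obtain ⟨D, hD, hone⟩ := hT
    have huniq : ∀ p ∈ D, ∀ q ∈ D, p ∈ B → q ∈ B → p = q :=
      fun p hp q hq hpB hqB => hone p hp q hq hpB hqB
    have hnot : ∀ z ∈ B, ∀ y, G.Adj z y → y ∉ B → z ∉ D := by
      intro z hz y hzy hy hzD
      obtain ⟨b, hb, hbz⟩ : ∃ b ∈ B, b ≠ z := by
        by_cases h : u = z
        · exact ⟨v, hv, by rw [← h]; exact huv.symm⟩
        · exact ⟨u, hu, h⟩
      obtain ⟨p, hp, hpB, hpz⟩ := F1 hG hB hz hb hbz hzy hy hD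
      exact hpz (huniq p hp z hzD hpB hz)
    have huD := hnot u hu c huc hc
    have hvD := hnot v hv d hvd hd
    have hDB : ∀ p ∈ D, p ∈ B → p = w := by
      intro p hp hpB
      rcases hall p hpB with e | e | e
      · subst e; exact absurd hp huD
      · subst e; exact absurd hp hvD
      · exact e
    have hwD : w ∈ D := by
      obtain ⟨p, hp, hpB, -⟩ := F1 hG hB hu hv huv.symm huc hc hD
      rw [← hDB p hp hpB]; exact hp
    have hwin : ∀ z, G.Adj w z → z ∈ B := by
      intro z hz
      by_contra hzB
      exact hnot w hw z hz hzB hwD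
    rcases le_total (x v) (x u) with h | h
    · exact K3_one hG hB hu hv hw huv huw hvw hall hwin huc hc hvd hd hD hDB hx h
    · exact K3_one hG hB hv hu hw huv.symm hvw huw hall' hwin hvd hd huc hc hD hDB hx h

end Part5

/-- In a graph with maximal spectral radius in `Bl(k,φ)`, every block with at
most `3` vertices is a pendant block. -/
theorem small_block_is_pendant (k φ : ℕ) (G : SimpleGraph (Fin k)) (hG : MaxSpecIn k φ G)
    (B : Set (Fin k)) (hB : IsBlock G B) (hcard : B.ncard ≤ 3) :
    IsPendantBlock G B := by
  obtain ⟨⟨hbg, hφ⟩, hmax⟩ := hG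
  have hs : Star G := star_of_blockGraph hbg
  have hE : Ext G := ⟨hbg.1, hs, fun H hc hst hd =>
    hmax H ⟨blockGraph_of_star hc hst, hd.trans hφ⟩⟩
  refine ⟨hB, ?_⟩
  rintro u ⟨hu, hucut⟩ v ⟨hv, hvcut⟩
  by_contra huv
  have hblk : Blk G B := blk_of_block hs hB (hbg.2 B hB)
  obtain ⟨c, huc, hc⟩ := outer_of_cut hblk huv hucut
  obtain ⟨d, hvd, hd⟩ := outer_of_cut hblk (Ne.symm huv) hvcut
  by_cases h3 : ∃ w ∈ B, w ≠ u ∧ w ≠ v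
  · obtain ⟨w, hw, hwu, hwv⟩ := h3
    refine K3 hE hblk hu hv hw huv hwu.symm hwv.symm ?_ huc hc hvd hd
    intro z hz
    by_contra hcon
    push Not at hcon
    have hsub : ({z, u, v, w} : Set (Fin k)) ⊆ B := by
      rintro y (rfl | rfl | rfl | rfl) <;> assumption
    have h4 : ({z, u, v, w} : Set (Fin k)).ncard = 4 := by
      rw [Set.ncard_insert_of_notMem (by
          rintro (h | h | h)
          · exact hcon.1 h
          · exact hcon.2.1 h
          · exact hcon.2.2 h) (Set.toFinite _),
        Set.ncard_insert_of_notMem (by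
          rintro (h | h)
          · exact huv h
          · exact hwu h.symm) (Set.toFinite _), Set.ncard_pair hwv.symm]
    have := Set.ncard_le_ncard hsub (Set.toFinite _)
    omega
  · push Not at h3
    refine K2 hE hblk hu hv huv huc hc hvd hd ?_
    intro z hz
    by_cases h : z = u
    · exact Or.inl h
    · exact Or.inr (h3 z hz h)

end SpectralBlock
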